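/- arXiv:1402.3232 — 5 statements merged into one kernel-verified Lean document; each statement's English description precedes it below -/
import Mathlib

section
/- Let Q ≥ 2, let v ∈ 𝒬_Q(ℓ₂) and let r > 0 satisfy 4r < s(v) < +∞. Then there exists a map Φ : 𝒬_Q(ℓ₂) → 𝒬_Q(ℓ₂) such that: (i) 𝒢(Φ(u), v) ≤ r for every u ∈ 𝒬_Q(ℓ₂); (ii) Φ(u) = u whenever 𝒢(u, v) < r; and (iii) Φ is 1-Lipschitz, i.e. 𝒢(Φ(u₁), Φ(u₂)) ≤ 𝒢(u₁, u₂) for all u₁, u₂ ∈ 𝒬_Q(ℓ₂). -/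
/- Multiple valued maps into a separable Hilbert space:
   Lipschitz retraction onto a small ball around a point with large splitting distance. -/

open scoped ENNReal
noncomputable section

/-- The separable Hilbert space `ℓ₂` of square-summable real sequences. -/
abbrev ell2 : Type := lp (fun _ : ℕ => ℝ) 2

/-- Two `Q`-tuples are equivalent when they differ by a permutation of the entries. -/
instance permSetoid (Q : ℕ) : Setoid (Fin Q → ell2) where
  r u v := ∃ σ : Equiv.Perm (Fin Q), u = v ∘ σ
  iseqv := by
    refine ⟨fun u => ⟨1, rfl⟩, ?_, ?_⟩
    · rintro u v ⟨σ, rfl⟩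
      exact ⟨σ.symm, by funext i; simp [Function.comp]⟩
    · rintro u v w ⟨σ, rfl⟩ ⟨τ, rfl⟩
      exact ⟨σ.trans τ, rfl⟩

/-- The space `𝒬_Q(ℓ₂)` of unordered `Q`-tuples of points of `ℓ₂`. -/
def QQ (Q : ℕ) : Type := Quotient (permSetoid Q)

/-- The distance `𝒢` computed on representatives:
`min_σ sqrt (∑ i ‖u i - v (σ i)‖²)`. -/
def gDistT {Q : ℕ} (u v : Fin Q → ell2) : ℝ :=
  ⨅ σ : Equiv.Perm (Fin Q), Real.sqrt (∑ i, ‖u i - v (σ i)‖ ^ 2)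

/-- The metric `𝒢` on `𝒬_Q(ℓ₂)`. -/
def GG {Q : ℕ} (u v : QQ Q) : ℝ := gDistT u.out v.out

/-- Splitting distance of a tuple: `min {‖u i - u j‖ : u i ≠ u j}`, `∞` if all entries agree. -/
def tSpl {Q : ℕ} (u : Fin Q → ell2) : ℝ≥0∞ :=
  ⨅ (p : Fin Q × Fin Q) (_ : u p.1 ≠ u p.2), (‖u p.1 - u p.2‖₊ : ℝ≥0∞)

/-- Splitting distance `s` on `𝒬_Q(ℓ₂)`. -/
def sSpl {Q : ℕ} (u : QQ Q) : ℝ≥0∞ := tSpl u.out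

/-- Diameter of a tuple: `max_{i,j} ‖u i - u j‖`. -/
def tDiam {Q : ℕ} (u : Fin Q → ell2) : ℝ :=
  ⨆ p : Fin Q × Fin Q, ‖u p.1 - u p.2‖

/-- Diameter `d` on `𝒬_Q(ℓ₂)`. -/
def dMax {Q : ℕ} (u : QQ Q) : ℝ := tDiam u.out

/-- The contraction factor, at distance `t` from the origin, of the radial map that fixes the ball
of radius `r`, folds back the shell between the radii `r` and `2 * r`, and vanishes elsewhere. -/
def foldFactor (r t : ℝ) : ℝ := if t ≤ r then 1 else max (2 * r - t) 0 / t

/-- The radial map fixing the ball of radius `r`, folding back the shell between the radii `r` and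
`2 * r`, and vanishing elsewhere. -/
def radialFold {E : Type*} [NormedAddCommGroup E] [NormedSpace ℝ E] (r : ℝ) (x : E) : E :=
  foldFactor r ‖x‖ • x

theorem foldFactor_nonneg {r t : ℝ} (ht : 0 ≤ t) : 0 ≤ foldFactor r t := by
  unfold foldFactor
  split_ifs <;> positivity

theorem foldFactor_le_one {r t : ℝ} (hr : 0 < r) : foldFactor r t ≤ 1 := by
  unfold foldFactor
  split_ifs with h
  · exact le_rfl
  · push Not at h
    rw [div_le_one (hr.trans h)]
    exact max_le (by linarith) (by linarith)

theorem foldFactor_mul_self {r t : ℝ} (hr : 0 < r) :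
    foldFactor r t * t = min t (max (2 * r - t) 0) := by
  unfold foldFactor
  split_ifs with h
  · rw [one_mul, min_eq_left (le_max_of_le_left (by linarith))]
  · push Not at h
    rw [div_mul_cancel₀ _ (hr.trans h).ne', min_eq_right (max_le (by linarith) (by linarith))]

section RadialFold

variable {E : Type*} [NormedAddCommGroup E]

theorem norm_radialFold [NormedSpace ℝ E] {r : ℝ} (hr : 0 < r) (x : E) :
    ‖radialFold r x‖ = min ‖x‖ (max (2 * r - ‖x‖) 0) := by
  rw [radialFold, norm_smul, Real.norm_of_nonneg (foldFactor_nonneg (norm_nonneg x)),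
    foldFactor_mul_self hr]

theorem radialFold_of_norm_le [NormedSpace ℝ E] {r : ℝ} {x : E} (hx : ‖x‖ ≤ r) :
    radialFold r x = x := by
  rw [radialFold, foldFactor, if_pos hx, one_smul]

theorem norm_radialFold_le [NormedSpace ℝ E] {r : ℝ} (hr : 0 < r) (x : E) :
    ‖radialFold r x‖ ≤ r := by
  rw [norm_radialFold hr]
  rcases le_total ‖x‖ r with h | h
  · exact min_le_of_left_le h
  · exact min_le_of_right_le (max_le (by linarith) hr.le)

theorem norm_radialFold_sub_le [InnerProductSpace ℝ E] {r : ℝ} (hr : 0 < r) (x y : E) :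
    ‖radialFold r x - radialFold r y‖ ≤ ‖x - y‖ := by
  refine le_of_sq_le_sq ?_ (norm_nonneg _)
  have hcs := real_inner_le_norm x y
  have ha := foldFactor_nonneg (r := r) (norm_nonneg x)
  have hb := foldFactor_nonneg (r := r) (norm_nonneg y)
  have hab : foldFactor r ‖x‖ * foldFactor r ‖y‖ ≤ 1 :=
    mul_le_one₀ (foldFactor_le_one hr) hb (foldFactor_le_one hr)
  have hprofile : (‖radialFold r x‖ - ‖radialFold r y‖) ^ 2 ≤ (‖x‖ - ‖y‖) ^ 2 := by
    rw [sq_le_sq, norm_radialFold hr, norm_radialFold hr]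
    refine (abs_min_sub_min_le_max _ _ _ _).trans (max_le le_rfl ?_)
    refine (abs_max_sub_max_le_max _ _ _ _).trans (max_le ?_ (by simp))
    rw [sub_sub_sub_cancel_left, abs_sub_comm]
  have hinner : inner ℝ (radialFold r x) (radialFold r y) =
      foldFactor r ‖x‖ * foldFactor r ‖y‖ * inner ℝ x y := by
    rw [radialFold, radialFold, real_inner_smul_left, real_inner_smul_right, mul_assoc]
  have hnorm : ‖radialFold r x‖ * ‖radialFold r y‖ =
      foldFactor r ‖x‖ * foldFactor r ‖y‖ * (‖x‖ * ‖y‖) := by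
    rw [radialFold, radialFold, norm_smul, norm_smul, Real.norm_of_nonneg ha,
      Real.norm_of_nonneg hb]
    ring
  rw [norm_sub_sq_real, norm_sub_sq_real, hinner]
  nlinarith [mul_nonneg (sub_nonneg.2 hab) (sub_nonneg.2 hcs)]

end RadialFold

section UnorderedTuples

variable {Q : ℕ}

/-- The Hilbert norm of a `Q`-tuple of points of `ℓ₂`. -/
abbrev tupleNorm (u : Fin Q → ell2) : ℝ := ‖WithLp.toLp 2 u‖

theorem tupleNorm_eq_sqrt (u : Fin Q → ell2) : tupleNorm u = √(∑ i, ‖u i‖ ^ 2) :=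
  PiLp.norm_eq_of_L2 _

theorem tupleNorm_comp_perm (u : Fin Q → ell2) (σ : Equiv.Perm (Fin Q)) :
    tupleNorm (u ∘ σ) = tupleNorm u := by
  rw [tupleNorm_eq_sqrt, tupleNorm_eq_sqrt]
  exact congrArg _ (Equiv.sum_comp σ fun i => ‖u i‖ ^ 2)

theorem tupleNorm_sub_comm (a b : Fin Q → ell2) : tupleNorm (a - b) = tupleNorm (b - a) := by
  rw [tupleNorm, tupleNorm, WithLp.toLp_sub, WithLp.toLp_sub, norm_sub_rev]

theorem tupleNorm_sub_le (a b c : Fin Q → ell2) :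
    tupleNorm (a - c) ≤ tupleNorm (a - b) + tupleNorm (b - c) := by
  simpa only [tupleNorm, WithLp.toLp_sub] using norm_sub_le_norm_sub_add_norm_sub _ _ _

/-- The unordered tuple `⊕ [[u i]]`. -/
def toQQ (u : Fin Q → ell2) : QQ Q := Quotient.mk (permSetoid Q) u

theorem toQQ_comp_perm (u : Fin Q → ell2) (σ : Equiv.Perm (Fin Q)) : toQQ (u ∘ σ) = toQQ u :=
  Quotient.sound ⟨σ, rfl⟩

theorem toQQ_out (x : QQ Q) : toQQ (Quotient.out x) = x := Quotient.out_eq x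

theorem exists_perm_of_toQQ_eq {a b : Fin Q → ell2} (h : toQQ a = toQQ b) :
    ∃ σ : Equiv.Perm (Fin Q), a = b ∘ σ :=
  Quotient.exact h

theorem gDistT_le (a b : Fin Q → ell2) (σ : Equiv.Perm (Fin Q)) :
    gDistT a b ≤ tupleNorm (a - b ∘ σ) := by
  rw [tupleNorm_eq_sqrt]
  exact ciInf_le (Set.finite_range _).bddBelow σ

theorem exists_perm_gDistT_eq (a b : Fin Q → ell2) :
    ∃ σ : Equiv.Perm (Fin Q), gDistT a b = tupleNorm (a - b ∘ σ) := by
  obtain ⟨σ, hσ⟩ := exists_eq_ciInf_of_finite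
    (f := fun σ : Equiv.Perm (Fin Q) => √(∑ i, ‖a i - b (σ i)‖ ^ 2))
  exact ⟨σ, by rw [tupleNorm_eq_sqrt]; exact hσ.symm⟩

theorem GG_toQQ_le (a b : Fin Q → ell2) : GG (toQQ a) (toQQ b) ≤ tupleNorm (a - b) := by
  obtain ⟨σ, hσ⟩ := exists_perm_of_toQQ_eq (toQQ_out (toQQ a))
  obtain ⟨τ, hτ⟩ := exists_perm_of_toQQ_eq (toQQ_out (toQQ b)).symm
  refine (gDistT_le _ _ (σ.trans τ)).trans_eq ?_
  rw [← tupleNorm_comp_perm (a - b) σ]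
  congr 1
  funext i
  rw [Pi.sub_apply, hσ]
  exact congrArg (a (σ i) - ·) (congrFun hτ (σ i)).symm

theorem exists_perm_GG_toQQ_eq (a b : Fin Q → ell2) :
    ∃ σ : Equiv.Perm (Fin Q), GG (toQQ a) (toQQ b) = tupleNorm (a - b ∘ σ) := by
  obtain ⟨σ, hσ⟩ := exists_perm_gDistT_eq (toQQ a).out (toQQ b).out
  obtain ⟨τ, hτ⟩ := exists_perm_of_toQQ_eq (toQQ_out (toQQ a)).symm
  obtain ⟨ρ, hρ⟩ := exists_perm_of_toQQ_eq (toQQ_out (toQQ b))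
  refine ⟨(τ.trans σ).trans ρ, hσ.trans ?_⟩
  rw [← tupleNorm_comp_perm _ τ]
  congr 1
  funext i
  have h₁ := congrFun hτ i
  have h₂ := congrFun hρ (σ (τ i))
  simp only [Function.comp_apply, Pi.sub_apply, Equiv.trans_apply] at h₁ h₂ ⊢
  rw [h₁, h₂]

theorem exists_toQQ_eq_GG_eq (x : QQ Q) (b : Fin Q → ell2) :
    ∃ a, toQQ a = x ∧ GG x (toQQ b) = tupleNorm (a - b) := by
  obtain ⟨σ, hσ⟩ := exists_perm_GG_toQQ_eq (Quotient.out x) b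
  rw [toQQ_out] at hσ
  refine ⟨Quotient.out x ∘ σ.symm, by rw [toQQ_comp_perm, toQQ_out], ?_⟩
  rw [hσ, ← tupleNorm_comp_perm (_ - b) σ]
  congr 1
  funext i
  simp

theorem GG_comm (x y : QQ Q) : GG x y = GG y x := by
  have key : ∀ x y : QQ Q, GG x y ≤ GG y x := by
    intro x y
    rw [← toQQ_out x]
    obtain ⟨b, rfl, hb⟩ := exists_toQQ_eq_GG_eq y (Quotient.out x)
    rw [hb, tupleNorm_sub_comm]
    exact GG_toQQ_le _ _
  exact le_antisymm (key x y) (key y x)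

theorem GG_triangle (x y z : QQ Q) : GG x z ≤ GG x y + GG y z := by
  rw [← toQQ_out z]
  obtain ⟨b, rfl, hb⟩ := exists_toQQ_eq_GG_eq y (Quotient.out z)
  obtain ⟨a, rfl, ha⟩ := exists_toQQ_eq_GG_eq x b
  rw [ha, hb]
  exact (GG_toQQ_le _ _).trans (tupleNorm_sub_le _ _ _)

theorem lt_norm_sub_of_lt_tSpl {w : Fin Q → ell2} {t : ℝ}
    (h : ENNReal.ofReal t < tSpl w) {i j : Fin Q} (hij : w i ≠ w j) : t < ‖w i - w j‖ := by
  have hlt : ENNReal.ofReal t < (‖w i - w j‖₊ : ℝ≥0∞) := h.trans_le (iInf₂_le (i, j) hij)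
  rw [← enorm_eq_nnnorm, ← ofReal_norm] at hlt
  exact (ENNReal.ofReal_lt_ofReal_iff'.1 hlt).1

/-- If the permutation `σ` moves some entry of `w`, then matching `a` with `b ∘ σ` is expensive for
tuples `a` and `b` close to `w`. -/
theorem lt_tupleNorm_add_of_comp_ne {w a b : Fin Q → ell2} {t : ℝ} {σ : Equiv.Perm (Fin Q)}
    (h : ENNReal.ofReal t < tSpl w) (hσ : w ∘ σ ≠ w) :
    t < tupleNorm (a - w) + tupleNorm (a - b ∘ σ) + tupleNorm (b - w) := by
  obtain ⟨i, hi⟩ := Function.ne_iff.1 hσ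
  have h₀ := lt_norm_sub_of_lt_tSpl h (Ne.symm hi)
  have h₁ : ‖a i - w i‖ ≤ tupleNorm (a - w) := PiLp.norm_apply_le (WithLp.toLp 2 (a - w)) i
  have h₂ : ‖a i - b (σ i)‖ ≤ tupleNorm (a - b ∘ σ) :=
    PiLp.norm_apply_le (WithLp.toLp 2 (a - b ∘ σ)) i
  have h₃ : ‖b (σ i) - w (σ i)‖ ≤ tupleNorm (b - w) :=
    PiLp.norm_apply_le (WithLp.toLp 2 (b - w)) (σ i)
  have h₄ := norm_sub_le_norm_sub_add_norm_sub (w i) (a i) (w (σ i))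
  have h₅ := norm_sub_le_norm_sub_add_norm_sub (a i) (b (σ i)) (w (σ i))
  rw [norm_sub_rev (w i) (a i)] at h₄
  linarith

/-- The radial fold of the tuple `a` towards the tuple `w`. -/
def tupleFold (r : ℝ) (w a : Fin Q → ell2) : Fin Q → ell2 :=
  w + WithLp.ofLp (radialFold r (WithLp.toLp 2 (a - w)))

theorem tupleNorm_tupleFold_sub (r : ℝ) (w a : Fin Q → ell2) :
    tupleNorm (tupleFold r w a - w) = ‖radialFold r (WithLp.toLp 2 (a - w))‖ := by
  rw [tupleNorm, tupleFold, add_sub_cancel_left, WithLp.toLp_ofLp]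

theorem tupleNorm_tupleFold_sub_tupleFold_le {r : ℝ} (hr : 0 < r) (w a b : Fin Q → ell2) :
    tupleNorm (tupleFold r w a - tupleFold r w b) ≤ tupleNorm (a - b) := by
  have h := norm_radialFold_sub_le hr (WithLp.toLp 2 (a - w)) (WithLp.toLp 2 (b - w))
  rw [← WithLp.toLp_sub 2 (a - w), sub_sub_sub_cancel_right] at h
  rwa [tupleNorm, tupleFold, tupleFold, add_sub_add_left_eq_sub, WithLp.toLp_sub,
    WithLp.toLp_ofLp, WithLp.toLp_ofLp]

theorem tupleFold_comp_perm (r : ℝ) {w : Fin Q → ell2} (a : Fin Q → ell2)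
    {σ : Equiv.Perm (Fin Q)} (hσ : w ∘ σ = w) :
    tupleFold r w (a ∘ σ) = tupleFold r w a ∘ σ := by
  have hnorm : tupleNorm (a ∘ σ - w) = tupleNorm (a - w) := by
    rw [← tupleNorm_comp_perm (a - w) σ, Pi.sub_comp, hσ]
  rw [tupleNorm, tupleNorm, WithLp.toLp_sub, WithLp.toLp_sub] at hnorm
  funext i
  have hi : w (σ i) = w i := congrFun hσ i
  simp [tupleFold, radialFold, hnorm, hi]

theorem tupleFold_of_tupleNorm_le {r : ℝ} {w a : Fin Q → ell2} (h : tupleNorm (a - w) ≤ r) :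
    tupleFold r w a = a := by
  rw [tupleFold, radialFold_of_norm_le h, add_sub_cancel]

/-- Folding tuples whose distance to `w` is realised entrywise does not increase `𝒢`. -/
theorem GG_toQQ_tupleFold_le {r : ℝ} (hr : 0 < r) {w a b : Fin Q → ell2}
    (hw : ENNReal.ofReal (4 * r) < tSpl w)
    (ha : GG (toQQ a) (toQQ w) = tupleNorm (a - w))
    (hb : GG (toQQ b) (toQQ w) = tupleNorm (b - w)) :
    GG (toQQ (tupleFold r w a)) (toQQ (tupleFold r w b)) ≤ GG (toQQ a) (toQQ b) := by
  obtain ⟨σ, hσ⟩ := exists_perm_GG_toQQ_eq a b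
  by_cases hwσ : w ∘ σ = w
  · rw [hσ, ← toQQ_comp_perm (tupleFold r w b) σ, ← tupleFold_comp_perm r b hwσ]
    exact (GG_toQQ_le _ _).trans (tupleNorm_tupleFold_sub_tupleFold_le hr w a (b ∘ σ))
  · have hsplit := lt_tupleNorm_add_of_comp_ne (a := a) (b := b) hw hwσ
    have hab := GG_triangle (toQQ a) (toQQ b) (toQQ w)
    have hba := GG_triangle (toQQ b) (toQQ a) (toQQ w)
    rw [GG_comm (toQQ b) (toQQ a)] at hba
    rw [ha, hb] at hab hba
    rw [← hσ] at hsplit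
    have hfold : ∀ c : Fin Q → ell2,
        tupleNorm (tupleFold r w c - w) ≤ max (2 * r - tupleNorm (c - w)) 0 := fun c => by
      rw [tupleNorm_tupleFold_sub, norm_radialFold hr]
      exact min_le_right _ _
    calc GG (toQQ (tupleFold r w a)) (toQQ (tupleFold r w b))
        ≤ tupleNorm (tupleFold r w a - tupleFold r w b) := GG_toQQ_le _ _
      _ ≤ tupleNorm (tupleFold r w a - w) + tupleNorm (tupleFold r w b - w) := by
        rw [tupleNorm_sub_comm (tupleFold r w b) w]
        exact tupleNorm_sub_le _ _ _
      _ ≤ max (2 * r - tupleNorm (a - w)) 0 + max (2 * r - tupleNorm (b - w)) 0 :=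
        add_le_add (hfold a) (hfold b)
      _ ≤ GG (toQQ a) (toQQ b) := by
        rcases max_cases (2 * r - tupleNorm (a - w)) 0 with ⟨h₁, h₁'⟩ | ⟨h₁, h₁'⟩ <;>
          rcases max_cases (2 * r - tupleNorm (b - w)) 0 with ⟨h₂, h₂'⟩ | ⟨h₂, h₂'⟩ <;>
          rw [h₁, h₂] <;> linarith

end UnorderedTuples

/-- If `Q ≥ 2`, `v ∈ 𝒬_Q(ℓ₂)` and `0 < r` with `4r < s(v) < ∞`,
there is a map `Φ : 𝒬_Q(ℓ₂) → 𝒬_Q(ℓ₂)` taking values in the closed ball `B_𝒢(v,r)`,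
fixing the open ball `B_𝒢(v,r)`, and `1`-Lipschitz for `𝒢`. -/
theorem stmt0 (Q : ℕ) (hQ : 2 ≤ Q) (v : QQ Q) (r : ℝ) (hr : 0 < r)
    (h4r : ENNReal.ofReal (4 * r) < sSpl v) (hfin : sSpl v < ⊤) :
    ∃ Φ : QQ Q → QQ Q,
      (∀ u, GG (Φ u) v ≤ r) ∧
      (∀ u, GG u v < r → Φ u = u) ∧
      (∀ u₁ u₂, GG (Φ u₁) (Φ u₂) ≤ GG u₁ u₂) := by
  have hw : toQQ (Quotient.out v) = v := toQQ_out v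
  choose a ha hav using fun u : QQ Q => exists_toQQ_eq_GG_eq u (Quotient.out v)
  refine ⟨fun u => toQQ (tupleFold r (Quotient.out v) (a u)), fun u => ?_, fun u hu => ?_,
    fun u₁ u₂ => ?_⟩
  · have h := GG_toQQ_le (tupleFold r (Quotient.out v) (a u)) (Quotient.out v)
    rw [hw, tupleNorm_tupleFold_sub] at h
    exact h.trans (norm_radialFold_le hr _)
  · rw [← hw, hav] at hu
    exact (congrArg toQQ (tupleFold_of_tupleNorm_le hu.le)).trans (ha u)
  · have h := GG_toQQ_tupleFold_le (a := a u₁) (b := a u₂) hr h4r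
      (by rw [ha, hav]) (by rw [ha, hav])
    rwa [ha, ha] at h
end
end

section
/- Let Q ≥ 2 and 0 < ε < 1, and set β(ε, Q) = (ε/3)^{3^Q}. Then for every P ∈ 𝒬_Q(ℓ₂) with s(P) < +∞ there exists a point P̃ ∈ 𝒬_Q(ℓ₂) such that β(ε, Q)·d(P) ≤ s(P̃) < +∞ and 𝒢(P̃, P) ≤ ε·s(P̃). -/
/- Multiple valued maps into a separable Hilbert space:
   Lipschitz retraction onto a small ball around a point with large splitting distance. -/

open scoped ENNReal
noncomputable section

/-- Successive merging of close values: a finite family `u` near a family `p` of diameter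
greater than `η * d` is turned into a family near `p` whose distinct values are far apart,
relative to the distance to `p`. -/
lemma exists_separated_family {ι E : Type*} [Finite ι] [NormedAddCommGroup E]
    {c η d : ℝ} (hc0 : 0 ≤ c) (hc1 : c ≤ 1) (hη : 0 ≤ η) (hd : 0 ≤ d)
    (hcη : (η + 1) * c ≤ η) (p : ι → E) {a b : ι} (hab : η * d < ‖p a - p b‖)
    (n : ℕ) (u : ι → E) (hcard : (Set.range u).ncard ≤ n + 1)
    (hu : ∀ i, ‖u i - p i‖ ≤ η * (c ^ n * (d / 2))) :
    ∃ (v : ι → E) (t : ℝ), c ^ n * (d / 2) ≤ t ∧ (∀ i j, v i ≠ v j → t ≤ ‖v i - v j‖) ∧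
      (∃ i j, v i ≠ v j) ∧ ∀ i, ‖v i - p i‖ ≤ η * t := by
  induction n generalizing u with
  | zero =>
    exfalso
    have hconst : u a = u b :=
      (Set.ncard_le_one (Set.finite_range u)).1 hcard _ ⟨a, rfl⟩ _ ⟨b, rfl⟩
    have htri := norm_sub_le_norm_sub_add_norm_sub (p a) (u a) (p b)
    have ha := hu a
    have hb := hu b
    rw [norm_sub_rev] at ha
    rw [← hconst] at hb
    simp only [pow_zero] at ha hb
    linarith
  | succ n ih =>
    by_cases hsep : ∀ i j, u i ≠ u j → c ^ (n + 1) * (d / 2) ≤ ‖u i - u j‖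
    · refine ⟨u, _, le_rfl, hsep, ⟨a, b, fun hconst => ?_⟩, hu⟩
      have htri := norm_sub_le_norm_sub_add_norm_sub (p a) (u a) (p b)
      have ha := hu a
      have hb := hu b
      rw [norm_sub_rev] at ha
      rw [← hconst] at hb
      have hle : η * (c ^ (n + 1) * (d / 2)) ≤ η * (1 * (d / 2)) := by
        gcongr
        exact pow_le_one₀ hc0 hc1
      linarith
    · push Not at hsep
      obtain ⟨i, j, hij, hlt⟩ := hsep
      classical
      let w : ι → E := fun k => if u k = u j then u i else u k
      have hwcard : (Set.range w).ncard ≤ n + 1 := by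
        have hss : Set.range w ⊂ Set.range u := by
          refine (Set.ssubset_iff_of_subset ?_).2 ⟨u j, ⟨j, rfl⟩, ?_⟩
          · rintro _ ⟨k, rfl⟩
            by_cases h : u k = u j <;> simp [w, h]
          · rintro ⟨k, hk⟩
            by_cases h : u k = u j <;> simp_all [w]
        have := Set.ncard_lt_ncard hss (Set.finite_range u)
        omega
      have hstep : η * (c ^ (n + 1) * (d / 2)) + c ^ (n + 1) * (d / 2)
          ≤ η * (c ^ n * (d / 2)) := by
        have := mul_le_mul_of_nonneg_right hcη (by positivity : 0 ≤ c ^ n * (d / 2))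
        linarith [show (η + 1) * c * (c ^ n * (d / 2)) =
          η * (c ^ (n + 1) * (d / 2)) + c ^ (n + 1) * (d / 2) by ring]
      have hw : ∀ k, ‖w k - p k‖ ≤ η * (c ^ n * (d / 2)) := by
        intro k
        have hk := hu k
        by_cases h : u k = u j
        · have htri := norm_sub_le_norm_sub_add_norm_sub (u i) (u j) (p k)
          rw [h] at hk
          simp only [w, h, if_true]
          linarith
        · have : 0 ≤ c ^ (n + 1) * (d / 2) := by positivity
          simp only [w, h, if_false]
          linarith
      obtain ⟨v, t, ht, hv⟩ := ih w hwcard hw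
      refine ⟨v, t, le_trans ?_ ht, hv⟩
      have := pow_le_pow_of_le_one hc0 hc1 (Nat.le_succ n)
      gcongr

lemma mul_self_add_one_le_three_pow {n : ℕ} (hn : 2 ≤ n) : n * n + 1 ≤ 3 ^ n := by
  induction n, hn using Nat.le_induction with
  | base => norm_num
  | succ n hn ih => rw [pow_succ]; nlinarith

lemma add_one_mul_div_three_pow_le {ε : ℝ} (hε0 : 0 < ε) (hε1 : ε < 1) {Q : ℕ} (hQ : 2 ≤ Q) :
    (Q + 1) * (ε / 3) ^ Q ≤ ε := by
  have h3 : ((Q : ℝ) + 1) ≤ 3 ^ Q := by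
    have := mul_self_add_one_le_three_pow hQ
    exact_mod_cast (by nlinarith : Q + 1 ≤ 3 ^ Q)
  have hpow : ε ^ Q ≤ ε := by
    simpa using pow_le_pow_of_le_one hε0.le hε1.le (by omega : 1 ≤ Q)
  rw [div_pow, mul_div_assoc', div_le_iff₀ (by positivity), mul_comm ε]
  exact mul_le_mul h3 hpow (by positivity) (by positivity)

lemma QQ.exists_out_mk_eq_comp {Q : ℕ} (v : Fin Q → ell2) :
    ∃ σ : Equiv.Perm (Fin Q), (Quotient.mk (permSetoid Q) v).out = v ∘ σ :=
  Quotient.mk_out v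

lemma gDistT_le_of_forall_norm_sub_le {Q : ℕ} {u v : Fin Q → ell2} (σ : Equiv.Perm (Fin Q))
    {r : ℝ} (hr : 0 ≤ r) (h : ∀ i, ‖u i - v (σ i)‖ ≤ r) : gDistT u v ≤ Q * r := by
  refine (ciInf_le ⟨0, ?_⟩ σ).trans (Real.sqrt_le_iff.2 ⟨by positivity, ?_⟩)
  · rintro _ ⟨τ, rfl⟩
    positivity
  · calc ∑ i, ‖u i - v (σ i)‖ ^ 2 ≤ ∑ _i : Fin Q, r ^ 2 := by
          gcongr with i
          exact h i
      _ = Q * r ^ 2 := by simp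
      _ ≤ (Q * Q : ℝ) * r ^ 2 := by
          gcongr
          exact_mod_cast Nat.le_mul_self Q
      _ = (Q * r) ^ 2 := by ring

lemma tSpl_lt_top_iff {Q : ℕ} {u : Fin Q → ell2} : tSpl u < ⊤ ↔ ∃ i j, u i ≠ u j := by
  simp [tSpl, iInf_lt_iff]

/-- (Lemma on large separation.) For `Q ≥ 2`, `0 < ε < 1` and
`β(ε,Q) = (ε/3)^(3^Q)`: every `P ∈ 𝒬_Q(ℓ₂)` with `s(P) < ∞` admits `P̃ ∈ 𝒬_Q(ℓ₂)` with
`β(ε,Q)·d(P) ≤ s(P̃) < ∞` and `𝒢(P̃, P) ≤ ε·s(P̃)`. -/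
theorem stmt2 (Q : ℕ) (hQ : 2 ≤ Q) (ε : ℝ) (hε0 : 0 < ε) (hε1 : ε < 1)
    (P : QQ Q) (hP : sSpl P < ⊤) :
    ∃ Pt : QQ Q,
      ENNReal.ofReal ((ε / 3) ^ (3 ^ Q) * dMax P) ≤ sSpl Pt ∧
      sSpl Pt < ⊤ ∧
      GG Pt P ≤ ε * (sSpl Pt).toReal := by
  obtain ⟨i₀, j₀, hne⟩ := tSpl_lt_top_iff.1 hP
  set p := P.out
  obtain ⟨⟨a, b⟩, hab⟩ : ∃ q : Fin Q × Fin Q, ‖p q.1 - p q.2‖ = dMax P := by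
    have : Nonempty (Fin Q × Fin Q) := ⟨(i₀, j₀)⟩
    exact exists_eq_ciSup_of_finite (f := fun q : Fin Q × Fin Q => ‖p q.1 - p q.2‖)
  have hd : 0 < dMax P :=
    (norm_pos_iff.2 (sub_ne_zero.2 hne)).trans_le
      (le_ciSup (f := fun q : Fin Q × Fin Q => ‖p q.1 - p q.2‖)
        (Set.finite_range _).bddAbove (i₀, j₀))
  have hQ0 : (0 : ℝ) < Q := by exact_mod_cast (by omega : 0 < Q)
  have hQ1 : (1 : ℝ) ≤ Q := by exact_mod_cast (by omega : 1 ≤ Q)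
  have hc := add_one_mul_div_three_pow_le hε0 hε1 hQ
  have hcη : (ε / Q + 1) * (ε / 3) ^ Q ≤ ε / Q := by
    rw [le_div_iff₀ hQ0]
    calc (ε / Q + 1) * (ε / 3) ^ Q * Q = (Q + ε) * (ε / 3) ^ Q := by field_simp; ring
      _ ≤ (Q + 1) * (ε / 3) ^ Q := by gcongr
      _ ≤ ε := hc
  have hη1 : ε / Q < 1 := by
    rw [div_lt_one hQ0]
    linarith
  have hcard : (Set.range p).ncard ≤ Q + 1 := by
    have := Set.ncard_image_le (f := p) (Set.finite_univ (α := Fin Q))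
    rw [Set.image_univ, Set.ncard_univ, Nat.card_fin] at this
    omega
  obtain ⟨v, t, ht, hsep, ⟨i, j, hij⟩, hclose⟩ :=
    exists_separated_family (by positivity) (pow_le_one₀ (by positivity) (by linarith))
      (by positivity) hd.le hcη p (a := a) (b := b)
      (by rw [hab]; exact mul_lt_of_lt_one_left hd hη1) Q p hcard
      (fun i => by rw [sub_self, norm_zero]; positivity)
  obtain ⟨σ, hσ⟩ := QQ.exists_out_mk_eq_comp v
  have hβ : (ε / 3) ^ (3 ^ Q) * dMax P ≤ t := by
    refine le_trans ?_ ht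
    calc (ε / 3) ^ (3 ^ Q) * dMax P ≤ (ε / 3) ^ (Q * Q + 1) * dMax P := by
          have := pow_le_pow_of_le_one (by positivity : 0 ≤ ε / 3) (by linarith)
            (mul_self_add_one_le_three_pow hQ)
          gcongr
      _ = ((ε / 3) ^ Q) ^ Q * (ε / 3 * dMax P) := by rw [pow_succ, pow_mul]; ring
      _ ≤ ((ε / 3) ^ Q) ^ Q * (dMax P / 2) := by
          gcongr
          nlinarith
  have ht0 : 0 ≤ t := le_trans (by positivity) hβ
  have hspl : ENNReal.ofReal t ≤ sSpl (Quotient.mk (permSetoid Q) v) := by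
    refine le_iInf₂ fun q hq => ?_
    rw [hσ] at hq ⊢
    rw [← enorm_eq_nnnorm, ← ofReal_norm]
    exact ENNReal.ofReal_le_ofReal (hsep _ _ hq)
  have hfin : sSpl (Quotient.mk (permSetoid Q) v) < ⊤ :=
    tSpl_lt_top_iff.2 ⟨σ.symm i, σ.symm j, by simpa [hσ] using hij⟩
  refine ⟨Quotient.mk (permSetoid Q) v, (ENNReal.ofReal_le_ofReal hβ).trans hspl, hfin, ?_⟩
  calc GG (Quotient.mk (permSetoid Q) v) P ≤ Q * (ε / Q * t) :=
        gDistT_le_of_forall_norm_sub_le σ (by positivity) fun i => by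
          rw [hσ]
          exact hclose (σ i)
    _ = ε * t := by field_simp
    _ ≤ ε * (sSpl (Quotient.mk (permSetoid Q) v)).toReal := by
        gcongr
        exact (ENNReal.ofReal_le_iff_le_toReal hfin.ne).1 hspl
end
end

section
/- Let Q ≥ 2 and set α(Q) = (1/9)·27^{−3^Q}. Let m ≥ 2, r > 0, and let u : ∂B(0,r) → 𝒬_Q(ℓ₂) be a Borel measurable map defined on the sphere ∂B(0,r) ⊂ ℝ^m. Suppose there exists P ∈ 𝒬_Q(ℓ₂) such that 𝒢(u(x), P) ≤ α(Q)·d(P) for ℋ^{m−1}-almost every x ∈ ∂B(0,r). Then there exist integers K, L with 1 ≤ K, L ≤ Q−1 and K + L = Q, and Borel measurable maps v : ∂B(0,r) → 𝒬_K(ℓ₂) and w : ∂B(0,r) → 𝒬_L(ℓ₂), such that u(x) = v(x) ⊕ w(x) for ℋ^{m−1}-almost every x ∈ ∂B(0,r). (This is the splitting statement of the paper's Proposition on decomposition of maps with values near a point P, with the Sobolev regularity hypothesis on u relaxed to Borel measurability; ℋ^{m−1} denotes (m−1)-dimensional Hausdorff measure.) -/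
/- Multiple valued maps into a separable Hilbert space:
   Lipschitz retraction onto a small ball around a point with large splitting distance. -/

open scoped ENNReal
noncomputable section

instance : MeasurableSpace ell2 := borel ell2
instance : BorelSpace ell2 := ⟨rfl⟩

instance (Q : ℕ) : MeasurableSpace (QQ Q) :=
  inferInstanceAs (MeasurableSpace (Quotient (permSetoid Q)))

/-- Concatenation `⊕ : 𝒬_K(ℓ₂) × 𝒬_L(ℓ₂) → 𝒬_{K+L}(ℓ₂)`. -/
def qAppend {K L : ℕ} (u : QQ K) (w : QQ L) : QQ (K + L) :=
  ⟦Fin.append u.out w.out⟧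

/-- Transport along an equality of the number of points. -/
def qCast {Q Q' : ℕ} (h : Q = Q') (u : QQ Q) : QQ Q' := h ▸ u

open MeasureTheory

open Classical in
/-- Two finite families with the same multiset of values differ by a permutation. -/
theorem exists_perm_of_map_univ_eq {ι β : Type*} [Fintype ι] {f g : ι → β}
    (h : Finset.univ.val.map f = Finset.univ.val.map g) : ∃ σ : Equiv.Perm ι, f = g ∘ σ := by
  have hcard (b : β) : Fintype.card {i // f i = b} = Fintype.card {i // g i = b} := by
    have hb := congrArg (Multiset.count b) h
    rw [Multiset.count_map, Multiset.count_map] at hb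
    rw [Fintype.card_subtype, Fintype.card_subtype]
    simpa [Finset.card, Finset.filter, eq_comm] using hb
  refine ⟨Equiv.ofFiberEquiv fun b => Fintype.equivOfCardEq (hcard b), ?_⟩
  funext i
  exact (Equiv.ofFiberEquiv_map _ i).symm

/-- The multiset of entries of a point of `𝒬_Q(ℓ₂)`. -/
def QQ.entries {Q : ℕ} (q : QQ Q) : Multiset ell2 :=
  Finset.univ.val.map q.out

/-- The class of a tuple in `𝒬_Q(ℓ₂)`. -/
def QQ.mk {Q : ℕ} (y : Fin Q → ell2) : QQ Q := Quotient.mk (permSetoid Q) y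

theorem QQ.mk_out {Q : ℕ} (q : QQ Q) : QQ.mk q.out = q := Quotient.out_eq q

theorem QQ.measurable_mk {Q : ℕ} : Measurable (QQ.mk : (Fin Q → ell2) → QQ Q) :=
  measurable_quotient_mk''

theorem QQ.entries_mk {Q : ℕ} (y : Fin Q → ell2) :
    (QQ.mk y).entries = Finset.univ.val.map y := by
  obtain ⟨σ, hσ⟩ := Quotient.mk_out (s := permSetoid Q) y
  have h : (QQ.mk y).entries = Finset.univ.val.map (y ∘ σ) :=
    congrArg (fun z : Fin Q → ell2 => Finset.univ.val.map z) hσ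
  rw [h, ← Multiset.map_map, Multiset.map_univ_val_equiv]

theorem QQ.entries_injective {Q : ℕ} : Function.Injective (QQ.entries : QQ Q → Multiset ell2) := by
  intro q q' h
  rw [← QQ.mk_out q, ← QQ.mk_out q']
  exact Quotient.sound (s := permSetoid Q) (exists_perm_of_map_univ_eq h)

theorem QQ.card_entries {Q : ℕ} (q : QQ Q) : q.entries.card = Q := by
  simp [QQ.entries]

theorem QQ.exists_entries_eq {Q : ℕ} {s : Multiset ell2} (hs : s.card = Q) :
    ∃ q : QQ Q, q.entries = s := by
  subst hs
  refine ⟨QQ.mk fun i => s.toList.get (i.cast (by simp)), ?_⟩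
  rw [QQ.entries_mk, Fin.univ_val_map]
  conv_rhs => rw [← s.coe_toList]
  congr 1
  apply List.ext_get <;> simp

theorem QQ.entries_qAppend {K L : ℕ} (v : QQ K) (w : QQ L) :
    (qAppend v w).entries = v.entries + w.entries := by
  have h : qAppend v w = QQ.mk (Fin.append v.out w.out) := rfl
  rw [h, QQ.entries_mk, QQ.entries, QQ.entries, Fin.univ_val_map, Fin.univ_val_map,
    Fin.univ_val_map, List.ofFn_fin_append, Multiset.coe_add]

theorem QQ.entries_qCast {Q Q' : ℕ} (h : Q = Q') (q : QQ Q) :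
    (qCast h q).entries = q.entries := by
  subst h; rfl

open Classical in
/-- The point of `𝒬_K(ℓ₂)` with entries `s`, when `s` has `K` elements. -/
def QQ.ofMultiset (K : ℕ) (s : Multiset ell2) : QQ K :=
  if h : s.card = K then (QQ.exists_entries_eq h).choose else QQ.mk 0

theorem QQ.entries_ofMultiset {K : ℕ} {s : Multiset ell2} (h : s.card = K) :
    (QQ.ofMultiset K s).entries = s := by
  rw [QQ.ofMultiset, dif_pos h]
  exact (QQ.exists_entries_eq h).choose_spec

open Classical in
/-- The entries of `q` lying in `A`, as a point of `𝒬_K(ℓ₂)` when there are `K` of them. -/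
def QQ.part {Q : ℕ} (K : ℕ) (A : Set ell2) (q : QQ Q) : QQ K :=
  QQ.ofMultiset K (q.entries.filter (· ∈ A))

open Classical in
theorem QQ.part_mk {Q K : ℕ} (A : Set ell2) (y : Fin Q → ell2) {s : Finset (Fin Q)}
    (hs : s.card = K) (h : ∀ i, i ∈ s ↔ y i ∈ A) :
    QQ.part K A (QQ.mk y) = QQ.mk (y ∘ s.orderEmbOfFin hs) := by
  have hfilter : (QQ.mk y).entries.filter (· ∈ A) = s.val.map y := by
    rw [QQ.entries_mk, Multiset.filter_map]
    congr 1
    have : s = Finset.univ.filter fun i => y i ∈ A := by ext i; simp [h]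
    rw [this]; rfl
  apply QQ.entries_injective
  rw [QQ.part, hfilter, QQ.entries_ofMultiset (by simpa using hs), QQ.entries_mk,
    ← Multiset.map_map]
  congr 1
  exact (congrArg Finset.val (Finset.map_orderEmbOfFin_univ s hs)).symm

open Classical in
theorem QQ.part_mk_of_card_ne {Q K : ℕ} (A : Set ell2) (y : Fin Q → ell2) {s : Finset (Fin Q)}
    (hs : s.card ≠ K) (h : ∀ i, i ∈ s ↔ y i ∈ A) :
    QQ.part K A (QQ.mk y) = QQ.mk 0 := by
  rw [QQ.part, QQ.ofMultiset, dif_neg]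
  rw [QQ.entries_mk, Multiset.filter_map, Multiset.card_map]
  have : s = Finset.univ.filter fun i => y i ∈ A := by ext i; simp [h]
  rw [this] at hs
  exact hs

theorem QQ.measurable_part {Q : ℕ} (K : ℕ) {A : Set ell2} (hA : MeasurableSet A) :
    Measurable (QQ.part K A : QQ Q → QQ K) := by
  classical
  refine measurable_from_quotient.2 fun T hT => ?_
  let G (s : Finset (Fin Q)) (y : Fin Q → ell2) : QQ K :=
    if hs : s.card = K then QQ.mk (y ∘ s.orderEmbOfFin hs) else QQ.mk 0
  have hG (s : Finset (Fin Q)) : Measurable (G s) := by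
    by_cases hs : s.card = K
    · simp only [G, dif_pos hs]
      exact QQ.measurable_mk.comp (measurable_pi_lambda _ fun i => measurable_pi_apply _)
    · simp only [G, dif_neg hs]
      exact measurable_const
  have hGpart (s : Finset (Fin Q)) (y : Fin Q → ell2) (h : ∀ i, i ∈ s ↔ y i ∈ A) :
      QQ.part K A (QQ.mk y) = G s y := by
    by_cases hs : s.card = K
    · simp only [G, dif_pos hs, QQ.part_mk A y hs h]
    · simp only [G, dif_neg hs, QQ.part_mk_of_card_ne A y hs h]
  have hpre : (fun y : Fin Q → ell2 => QQ.part K A (QQ.mk y)) ⁻¹' T =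
      ⋃ s : Finset (Fin Q), (⋂ i, {y | i ∈ s ↔ y i ∈ A}) ∩ G s ⁻¹' T := by
    ext y
    simp only [Set.mem_preimage, Set.mem_iUnion, Set.mem_inter_iff, Set.mem_iInter,
      Set.mem_ofPred_eq]
    constructor
    · intro hy
      have h (i : Fin Q) : i ∈ Finset.univ.filter (fun i => y i ∈ A) ↔ y i ∈ A := by simp
      exact ⟨_, h, hGpart _ y h ▸ hy⟩
    · rintro ⟨s, h, hy⟩
      rwa [hGpart s y h]
  change MeasurableSet ((fun y : Fin Q → ell2 => QQ.part K A (QQ.mk y)) ⁻¹' T)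
  rw [hpre]
  refine MeasurableSet.iUnion fun s => (MeasurableSet.iInter fun i => ?_).inter (hG s hT)
  have hi : MeasurableSet {y : Fin Q → ell2 | y i ∈ A} := measurable_pi_apply i hA
  by_cases his : i ∈ s
  · simpa [his] using hi
  · simp only [his, false_iff]
    exact hi.compl

open Classical in
theorem QQ.eq_qCast_qAppend_part {Q K L : ℕ} (h : Q = K + L) (A : Set ell2) (q : QQ Q)
    (hK : (q.entries.filter (· ∈ A)).card = K) :
    q = qCast h.symm (qAppend (QQ.part K A q) (QQ.part L Aᶜ q)) := by
  have hsum := Multiset.filter_add_not (· ∈ A) q.entries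
  have hL : (q.entries.filter (· ∈ Aᶜ)).card = L := by
    have := congrArg Multiset.card hsum
    rw [Multiset.card_add, hK, q.card_entries] at this
    exact Nat.add_left_cancel (this.trans h)
  apply QQ.entries_injective
  rw [QQ.entries_qCast, QQ.entries_qAppend, QQ.part, QQ.part, QQ.entries_ofMultiset hK,
    QQ.entries_ofMultiset (by convert hL)]
  convert hsum.symm

theorem GG_le_exists_perm {Q : ℕ} {q p : QQ Q} {ε : ℝ} (h : GG q p ≤ ε) :
    ∃ σ : Equiv.Perm (Fin Q), ∀ i, ‖q.out i - p.out (σ i)‖ ≤ ε := by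
  obtain ⟨σ, hσ⟩ := exists_eq_ciInf_of_finite
    (f := fun σ : Equiv.Perm (Fin Q) => Real.sqrt (∑ i, ‖q.out i - p.out (σ i)‖ ^ 2))
  refine ⟨σ, fun i => le_trans ?_ (hσ.le.trans h)⟩
  apply Real.le_sqrt_of_sq_le
  exact Finset.single_le_sum (f := fun i => ‖q.out i - p.out (σ i)‖ ^ 2)
    (fun j _ => sq_nonneg _) (Finset.mem_univ i)

/-- Among `n` reals, one of which is `0`, some level of `(0, d)` is far from all of them. -/
theorem exists_level_far_from {n : ℕ} {f : Fin n → ℝ} {d ε : ℝ} (hd : 0 < d)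
    (hε : ε * (2 * n) < d) {i₀ : Fin n} (h₀ : f i₀ = 0) :
    ∃ c, 0 < c ∧ c < d ∧ ∀ i, ε < |f i - c| := by
  have hn : (0 : ℝ) < n := by exact_mod_cast i₀.pos
  set δ := d / (2 * n) with hδ
  have hδ0 : 0 < δ := by positivity
  have hdδ : d = 2 * n * δ := by rw [hδ]; field_simp
  have hεδ : ε < δ := by rw [hδ, lt_div_iff₀ (by positivity)]; exact hε
  by_contra! hcon
  have hbad (k : Fin n) : ∃ i, |f i - (2 * (k : ℕ) + 1) * δ| ≤ ε := by
    refine hcon _ (by positivity) ?_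
    have hk : ((k : ℕ) : ℝ) + 1 ≤ n := by exact_mod_cast k.isLt
    rw [hdδ]
    nlinarith
  choose g hg using hbad
  have hlt {k l : Fin n} (hkl : k < l) : g k ≠ g l := by
    intro he
    have h1 := abs_le.1 (hg k)
    have h2 := abs_le.1 (hg l)
    rw [he] at h1
    have hk : ((k : ℕ) : ℝ) + 1 ≤ (l : ℕ) := by exact_mod_cast hkl
    nlinarith
  have hinj : Function.Injective g := by
    intro k l he
    by_contra hne
    rcases lt_or_gt_of_ne hne with h | h
    · exact hlt h he
    · exact hlt h he.symm
  obtain ⟨k, hk⟩ := Finite.surjective_of_injective hinj i₀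
  have h1 := abs_le.1 (hg k)
  rw [hk, h₀] at h1
  have : (0 : ℝ) ≤ (k : ℕ) := by positivity
  nlinarith

open Classical in
/-- A ball whose boundary sphere stays `ε`-away from the entries of `P` contains as many entries
of any `ε`-close `q` as of `P`. -/
theorem card_filter_ball_eq {Q : ℕ} {q P : QQ Q} {ε c : ℝ} {a : ell2} (h : GG q P ≤ ε)
    (hc : ∀ i, ε < |‖P.out i - a‖ - c|) :
    (q.entries.filter (· ∈ Metric.ball a c)).card =
      (P.entries.filter (· ∈ Metric.ball a c)).card := by
  obtain ⟨σ, hσ⟩ := GG_le_exists_perm h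
  have hP : P.entries = Finset.univ.val.map (P.out ∘ σ) := by
    rw [← Multiset.map_map, Multiset.map_univ_val_equiv]; rfl
  rw [hP, QQ.entries, Multiset.filter_map, Multiset.filter_map, Multiset.card_map,
    Multiset.card_map]
  congr 1
  refine Multiset.filter_congr fun i _ => ?_
  simp only [Function.comp_apply, Metric.mem_ball, dist_eq_norm]
  have h1 := hσ i
  have h2 := hc (σ i)
  have h3 : |‖q.out i - a‖ - ‖P.out (σ i) - a‖| ≤ ‖q.out i - P.out (σ i)‖ := by
    simpa using abs_norm_sub_norm_le (q.out i - a) (P.out (σ i) - a)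
  have h4 := abs_le.1 (h3.trans h1)
  rcases lt_abs.1 h2 with h5 | h5 <;> constructor <;> intro h6 <;> linarith

theorem alpha_mul_lt {Q : ℕ} : (1 / 9) * ((27 : ℝ) ^ (3 ^ Q))⁻¹ * (2 * Q) < 1 := by
  have h : Q < 27 ^ (3 ^ Q) :=
    (Nat.lt_pow_self (by norm_num : 1 < 3)).trans (Nat.lt_pow_self (by norm_num))
  have h' : (Q : ℝ) < 27 ^ (3 ^ Q) := by exact_mod_cast h
  have hpos : (0 : ℝ) < 27 ^ (3 ^ Q) := by positivity
  have hdiv : ((27 : ℝ) ^ (3 ^ Q))⁻¹ * Q < 1 := by rwa [inv_mul_lt_one₀ hpos]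
  linarith

theorem GG_eq_of_le_zero {Q : ℕ} {q P : QQ Q} (h : GG q P ≤ 0) : q = P := by
  obtain ⟨σ, hσ⟩ := GG_le_exists_perm h
  rw [← QQ.mk_out q, ← QQ.mk_out P]
  refine Quotient.sound (s := permSetoid Q) ⟨σ, funext fun i => ?_⟩
  exact sub_eq_zero.1 (norm_le_zero_iff.1 (hσ i))

theorem QQ.exists_eq_qAppend {Q K L : ℕ} (h : Q = K + L) (q : QQ Q) :
    ∃ (v : QQ K) (w : QQ L), q = qCast h.symm (qAppend v w) := by
  subst h
  refine ⟨QQ.mk fun i => q.out (Fin.castAdd L i), QQ.mk fun i => q.out (Fin.natAdd K i), ?_⟩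
  apply QQ.entries_injective
  rw [QQ.entries_qCast, QQ.entries_qAppend, QQ.entries_mk, QQ.entries_mk, QQ.entries,
    Fin.univ_val_map, Fin.univ_val_map, Fin.univ_val_map, Multiset.coe_add,
    ← List.ofFn_fin_append, Fin.append_castAdd_natAdd]

/-- Splitting of Borel measurable maps on a sphere whose values stay
`α(Q)·d(P)`-close to a point `P`, with `α(Q) = (1/9)·27^(−3^Q)`:  such a map decomposes
ℋ^{m−1}-a.e. as a concatenation `u = v ⊕ w` of measurable maps with values in
`𝒬_K(ℓ₂)` and `𝒬_L(ℓ₂)`, `K + L = Q`, `1 ≤ K, L ≤ Q − 1`. -/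
theorem stmt3 (Q : ℕ) (hQ : 2 ≤ Q) (m : ℕ) (hm : 2 ≤ m) (r : ℝ) (hr : 0 < r)
    (u : EuclideanSpace ℝ (Fin m) → QQ Q) (hu : Measurable u)
    (P : QQ Q)
    (hclose : ∀ᵐ x ∂((μH[((m : ℝ) - 1)] :
        Measure (EuclideanSpace ℝ (Fin m))).restrict (Metric.sphere 0 r)),
      GG (u x) P ≤ (1 / 9) * ((27 : ℝ) ^ (3 ^ Q))⁻¹ * dMax P) :
    ∃ (K L : ℕ), 1 ≤ K ∧ K ≤ Q - 1 ∧ 1 ≤ L ∧ L ≤ Q - 1 ∧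
      ∃ (h : Q = K + L) (v : EuclideanSpace ℝ (Fin m) → QQ K)
        (w : EuclideanSpace ℝ (Fin m) → QQ L),
        Measurable v ∧ Measurable w ∧
        ∀ᵐ x ∂((μH[((m : ℝ) - 1)] :
            Measure (EuclideanSpace ℝ (Fin m))).restrict (Metric.sphere 0 r)),
          u x = qCast h.symm (qAppend (v x) (w x)) := by
  classical
  by_cases hd : dMax P ≤ 0
  · have hQ' : Q = 1 + (Q - 1) := by omega
    obtain ⟨v, w, hvw⟩ := QQ.exists_eq_qAppend hQ' P
    refine ⟨1, Q - 1, le_rfl, by omega, by omega, le_rfl, hQ', fun _ => v, fun _ => w,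
      measurable_const, measurable_const, ?_⟩
    filter_upwards [hclose] with x hx
    rw [← hvw]
    exact GG_eq_of_le_zero (hx.trans (mul_nonpos_of_nonneg_of_nonpos (by positivity) hd))
  · push Not at hd
    have : Nonempty (Fin Q) := ⟨⟨0, by omega⟩⟩
    obtain ⟨⟨i₀, j₀⟩, hij⟩ := exists_eq_ciSup_of_finite
      (f := fun p : Fin Q × Fin Q => ‖P.out p.1 - P.out p.2‖)
    replace hij : ‖P.out j₀ - P.out i₀‖ = dMax P := by rw [norm_sub_rev]; exact hij
    obtain ⟨c, hc0, hcd, hc⟩ := exists_level_far_from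
      (f := fun i => ‖P.out i - P.out i₀‖) (i₀ := i₀)
      (ε := (1 / 9) * ((27 : ℝ) ^ (3 ^ Q))⁻¹ * dMax P) hd
      (by nlinarith [alpha_mul_lt (Q := Q)]) (by simp)
    set A := Metric.ball (P.out i₀) c with hA
    set K := (P.entries.filter (· ∈ A)).card with hK
    have hmem (i : Fin Q) : P.out i ∈ P.entries :=
      Multiset.mem_map_of_mem _ (Finset.mem_univ i)
    have hK1 : 1 ≤ K := Multiset.card_pos_iff_exists_mem.2
      ⟨P.out i₀, Multiset.mem_filter.2 ⟨hmem i₀, Metric.mem_ball_self hc0⟩⟩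
    have hKQ : K < Q := by
      refine lt_of_lt_of_eq (Multiset.card_lt_card
        ((Multiset.filter_le _ _).lt_of_ne fun he => ?_)) P.card_entries
      have hj := Multiset.filter_eq_self.1 he _ (hmem j₀)
      rw [hA, Metric.mem_ball, dist_eq_norm, hij] at hj
      exact absurd hj hcd.le.not_gt
    have hQK : Q = K + (Q - K) := by omega
    refine ⟨K, Q - K, hK1, by omega, by omega, by omega, hQK,
      fun x => QQ.part K A (u x), fun x => QQ.part (Q - K) Aᶜ (u x),
      (QQ.measurable_part K Metric.isOpen_ball.measurableSet).comp hu,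
      (QQ.measurable_part (Q - K) Metric.isOpen_ball.measurableSet.compl).comp hu, ?_⟩
    filter_upwards [hclose] with x hx
    exact QQ.eq_qCast_qAppend_part hQK A (u x) (card_filter_ball_eq hx hc)
end
end

section
/- Let Y : U × ℓ₂ → ℓ₂ be a C¹ map which is bounded, has bounded derivative, and is such that the set {x ∈ U : Y(x,·) is not identically 0} is relatively compact in U. Then the function t ↦ ∫_U ‖D(f(·) + t·Y(·, f(·)))‖²_HS is differentiable at t = 0 with derivative 2∫_U ⟨Df(x), D_xY(x, f(x)) + D_yY(x, f(x))∘Df(x)⟩ dx. In particular, f is squash stationary if and only if ∫_U ⟨Df(x), D_xY(x, f(x))⟩ dx + ∫_U ⟨Df(x), D_yY(x, f(x))∘Df(x)⟩ dx = 0 for every such Y, where D_xY and D_yY denote the partial derivatives of Y in the first and second variable. -/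
open MeasureTheory Metric
open scoped RealInnerProductSpace ENNReal NNReal Topology
noncomputable section

/-- Euclidean space `ℝ^m`. -/
abbrev Em (m : ℕ) : Type := EuclideanSpace ℝ (Fin m)

/-- Squared Hilbert–Schmidt norm `‖A‖²_HS = ∑ i ‖A eᵢ‖²` of `A : ℝ^m →L ℓ₂`. -/
def hsNormSq {m : ℕ} (A : Em m →L[ℝ] ell2) : ℝ :=
  ∑ i : Fin m, ‖A (EuclideanSpace.single i 1)‖ ^ 2

/-- Hilbert–Schmidt inner product `⟨A,B⟩ = ∑ i ⟨A eᵢ, B eᵢ⟩`. -/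
def hsInner {m : ℕ} (A B : Em m →L[ℝ] ell2) : ℝ :=
  ∑ i : Fin m, ⟪A (EuclideanSpace.single i 1), B (EuclideanSpace.single i 1)⟫

/-- Divergence `div X = ∑ i ⟨DX(x) eᵢ, eᵢ⟩` of a vector field `X : ℝ^m → ℝ^m`. -/
def divg {m : ℕ} (X : Em m → Em m) (x : Em m) : ℝ :=
  ∑ i : Fin m, ⟪fderiv ℝ X x (EuclideanSpace.single i 1), EuclideanSpace.single i 1⟫

/-- `f` is squeeze stationary on `U`: for every smooth compactly supported vector field
`X` with support in `U`, the inner variation `t ↦ ∫_U ‖D(f ∘ Φ_t)‖²_HS`,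
`Φ_t(x) = x + tX(x)`, has derivative `0` at `t = 0`. -/
def SqueezeStationary {m : ℕ} (U : Set (Em m)) (f : Em m → ell2) : Prop :=
  ∀ X : Em m → Em m, ContDiff ℝ (⊤ : ℕ∞) X → HasCompactSupport X → tsupport X ⊆ U →
    HasDerivAt
      (fun t : ℝ => ∫ x in U, hsNormSq (fderiv ℝ (fun y => f (y + t • X y)) x)) 0 0

/-- `f` is squash stationary on `U`: for every `C¹` map `Y : U × ℓ₂ → ℓ₂` which is
bounded, has bounded derivative, and with `{x : Y(x,·) ≢ 0}` relatively compact in `U`,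
the outer variation `t ↦ ∫_U ‖D(f + tY(·, f(·)))‖²_HS` has derivative `0` at `t = 0`. -/
def SquashStationary {m : ℕ} (U : Set (Em m)) (f : Em m → ell2) : Prop :=
  ∀ Y : Em m × ell2 → ell2, ContDiff ℝ 1 Y →
    (∃ C, ∀ p, ‖Y p‖ ≤ C) → (∃ C, ∀ p, ‖fderiv ℝ Y p‖ ≤ C) →
    IsCompact (closure {x : Em m | ∃ y, Y (x, y) ≠ 0}) →
    closure {x : Em m | ∃ y, Y (x, y) ≠ 0} ⊆ U →
    HasDerivAt
      (fun t : ℝ =>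
        ∫ x in U, hsNormSq (fderiv ℝ (fun z => f z + t • Y (z, f z)) x)) 0 0
/-- Expansion of the squared Hilbert–Schmidt norm along a line. -/
lemma hsNormSq_add_smul {m : ℕ} (A B : Em m →L[ℝ] ell2) (t : ℝ) :
    hsNormSq (A + t • B) = hsNormSq A + t * (2 * hsInner A B) + t ^ 2 * hsNormSq B := by
  simp only [hsNormSq, hsInner, Finset.mul_sum, ← Finset.sum_add_distrib]
  refine Finset.sum_congr rfl fun i _ => ?_
  rw [add_apply, smul_apply, norm_add_sq_real,
    inner_smul_right, norm_smul, mul_pow, Real.norm_eq_abs, sq_abs]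
  ring

lemma hsInner_add_right {m : ℕ} (A B C : Em m →L[ℝ] ell2) :
    hsInner A (B + C) = hsInner A B + hsInner A C := by
  simp [hsInner, inner_add_right, Finset.sum_add_distrib]

lemma hsInner_zero_right {m : ℕ} (A : Em m →L[ℝ] ell2) : hsInner A 0 = 0 := by
  simp [hsInner]

lemma hsNormSq_zero {m : ℕ} : hsNormSq (0 : Em m →L[ℝ] ell2) = 0 := by
  simp [hsNormSq]

lemma ContinuousOn.hsInner {m : ℕ} {U : Set (Em m)} {A B : Em m → (Em m →L[ℝ] ell2)}
    (hA : ContinuousOn A U) (hB : ContinuousOn B U) :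
    ContinuousOn (fun x => hsInner (A x) (B x)) U :=
  continuousOn_finsetSum _ fun _ _ =>
    (hA.clm_apply continuousOn_const).inner (hB.clm_apply continuousOn_const)

lemma ContinuousOn.hsNormSq {m : ℕ} {U : Set (Em m)} {A : Em m → (Em m →L[ℝ] ell2)}
    (hA : ContinuousOn A U) : ContinuousOn (fun x => hsNormSq (A x)) U :=
  continuousOn_finsetSum _ fun _ _ => (hA.clm_apply continuousOn_const).norm.pow 2

/-- A function continuous on a measurable set and vanishing there outside a compact subset is
integrable on that set. -/
lemma ContinuousOn.integrableOn_of_eq_zero_off_compact {m : ℕ} {U K : Set (Em m)}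
    {g : Em m → ℝ} (hg : ContinuousOn g U) (hU : MeasurableSet U) (hK : IsCompact K)
    (hKU : K ⊆ U) (h0 : ∀ x ∈ U \ K, g x = 0) : IntegrableOn g U volume :=
  ((hg.mono hKU).integrableOn_compact hK).of_forall_sdiff_eq_zero hU h0

/-- The derivative of `Y` vanishes over points outside the closure of its base support. -/
lemma fderiv_eq_zero_of_notMem_closure {E F G : Type*} [NormedAddCommGroup E] [NormedSpace ℝ E]
    [NormedAddCommGroup F] [NormedSpace ℝ F] [NormedAddCommGroup G] [NormedSpace ℝ G]
    {Y : E × F → G} {x : E} (hx : x ∉ closure {x : E | ∃ y, Y (x, y) ≠ 0}) (y : F) :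
    fderiv ℝ Y (x, y) = 0 := by
  have h : Y =ᶠ[𝓝 (x, y)] fun _ => 0 := by
    have hfst := continuousAt_fst (p := (x, y)) |>.eventually
      (isClosed_closure.isOpen_compl.mem_nhds hx)
    filter_upwards [hfst] with p hp
    by_contra hne
    exact hp (subset_closure ⟨p.2, hne⟩)
  rw [h.fderiv_eq, fderiv_fun_const]
  rfl

/-- The derivative of the outer variation `z ↦ f z + t • Y (z, f z)`. -/
lemma fderiv_outer_variation {m : ℕ} {f : Em m → ell2} {L : Em m →L[ℝ] ell2} {x : Em m}
    (hf : HasFDerivAt f L x) {Y : Em m × ell2 → ell2} (hY : ContDiff ℝ 1 Y) (t : ℝ) :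
    fderiv ℝ (fun z => f z + t • Y (z, f z)) x =
      L + t • ((fderiv ℝ Y (x, f x)).comp (ContinuousLinearMap.inl ℝ (Em m) ell2)
        + ((fderiv ℝ Y (x, f x)).comp (ContinuousLinearMap.inr ℝ (Em m) ell2)).comp L) := by
  have hYd : HasFDerivAt Y (fderiv ℝ Y (x, f x)) (x, f x) :=
    (hY.differentiable one_ne_zero _).hasFDerivAt
  have hpair := (hasFDerivAt_id (𝕜 := ℝ) x).prodMk hf
  have hcomp : HasFDerivAt (fun z => Y (z, f z)) _ x := hYd.comp x hpair
  rw [(hf.fun_add (hcomp.fun_const_smul t)).fderiv]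
  congr 2
  ext1 v
  simp [← map_add]

/-- First outer (squash) variation formula: for every admissible
`Y : U × ℓ₂ → ℓ₂` (C¹, bounded, with bounded derivative, `{x : Y(x,·) ≢ 0}` relatively
compact in `U`), `t ↦ ∫_U ‖D(f + tY(·,f(·)))‖²_HS` is differentiable at `t = 0` with
derivative `2∫_U ⟨Df, D_xY(·,f) + D_yY(·,f)∘Df⟩`; consequently `f` is squash stationary
iff `∫_U ⟨Df, D_xY(·,f)⟩ + ∫_U ⟨Df, D_yY(·,f)∘Df⟩ = 0` for every such `Y`. -/
theorem stmt7 (m : ℕ) (hm : 2 ≤ m) (U : Set (Em m)) (hU : IsOpen U)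
    (f : Em m → ell2) (f' : Em m → (Em m →L[ℝ] ell2))
    (hf : ∀ x ∈ U, HasFDerivAt f (f' x) x) (hf'c : ContinuousOn f' U)
    (hfin : IntegrableOn (fun x => hsNormSq (f' x)) U volume) :
    (∀ Y : Em m × ell2 → ell2, ContDiff ℝ 1 Y →
      (∃ C, ∀ p, ‖Y p‖ ≤ C) → (∃ C, ∀ p, ‖fderiv ℝ Y p‖ ≤ C) →
      IsCompact (closure {x : Em m | ∃ y, Y (x, y) ≠ 0}) →
      closure {x : Em m | ∃ y, Y (x, y) ≠ 0} ⊆ U →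
      HasDerivAt
        (fun t : ℝ =>
          ∫ x in U, hsNormSq (fderiv ℝ (fun z => f z + t • Y (z, f z)) x))
        (2 * ∫ x in U, hsInner (f' x)
          ((fderiv ℝ Y (x, f x)).comp (ContinuousLinearMap.inl ℝ (Em m) ell2)
            + ((fderiv ℝ Y (x, f x)).comp
                (ContinuousLinearMap.inr ℝ (Em m) ell2)).comp (f' x))) 0) ∧
    (SquashStationary U f ↔
      ∀ Y : Em m × ell2 → ell2, ContDiff ℝ 1 Y →
        (∃ C, ∀ p, ‖Y p‖ ≤ C) → (∃ C, ∀ p, ‖fderiv ℝ Y p‖ ≤ C) →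
        IsCompact (closure {x : Em m | ∃ y, Y (x, y) ≠ 0}) →
        closure {x : Em m | ∃ y, Y (x, y) ≠ 0} ⊆ U →
        (∫ x in U, hsInner (f' x)
            ((fderiv ℝ Y (x, f x)).comp (ContinuousLinearMap.inl ℝ (Em m) ell2)))
          + (∫ x in U, hsInner (f' x)
              (((fderiv ℝ Y (x, f x)).comp
                  (ContinuousLinearMap.inr ℝ (Em m) ell2)).comp (f' x))) = 0) := by
  have hUm := hU.measurableSet
  have hfc : ContinuousOn f U := fun x hx => (hf x hx).continuousAt.continuousWithinAt
  have hDY : ∀ Y : Em m × ell2 → ell2, ContDiff ℝ 1 Y →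
      ContinuousOn (fun x => fderiv ℝ Y (x, f x)) U := fun Y hY =>
    (hY.continuous_fderiv one_ne_zero).comp_continuousOn (continuousOn_id.prodMk hfc)
  have hDx : ∀ Y : Em m × ell2 → ell2, ContDiff ℝ 1 Y → ContinuousOn (fun x =>
      (fderiv ℝ Y (x, f x)).comp (ContinuousLinearMap.inl ℝ (Em m) ell2)) U := fun Y hY =>
    (hDY Y hY).clm_comp continuousOn_const
  have hDy : ∀ Y : Em m × ell2 → ell2, ContDiff ℝ 1 Y → ContinuousOn (fun x =>
      ((fderiv ℝ Y (x, f x)).comp (ContinuousLinearMap.inr ℝ (Em m) ell2)).comp (f' x)) U :=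
    fun Y hY => ((hDY Y hY).clm_comp continuousOn_const).clm_comp hf'c
  have hvar : ∀ Y : Em m × ell2 → ell2, ContDiff ℝ 1 Y →
      IsCompact (closure {x : Em m | ∃ y, Y (x, y) ≠ 0}) →
      closure {x : Em m | ∃ y, Y (x, y) ≠ 0} ⊆ U →
      HasDerivAt
        (fun t : ℝ =>
          ∫ x in U, hsNormSq (fderiv ℝ (fun z => f z + t • Y (z, f z)) x))
        (2 * ∫ x in U, hsInner (f' x)
          ((fderiv ℝ Y (x, f x)).comp (ContinuousLinearMap.inl ℝ (Em m) ell2)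
            + ((fderiv ℝ Y (x, f x)).comp
                (ContinuousLinearMap.inr ℝ (Em m) ell2)).comp (f' x))) 0 := by
    intro Y hY hK hKU
    set G : Em m → (Em m →L[ℝ] ell2) := fun x =>
      (fderiv ℝ Y (x, f x)).comp (ContinuousLinearMap.inl ℝ (Em m) ell2)
        + ((fderiv ℝ Y (x, f x)).comp
            (ContinuousLinearMap.inr ℝ (Em m) ell2)).comp (f' x) with hG
    have hGc : ContinuousOn G U := (hDx Y hY).add (hDy Y hY)
    have hG0 : ∀ x ∈ U \ closure {x : Em m | ∃ y, Y (x, y) ≠ 0}, G x = 0 := fun x hx => by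
      simp [hG, fderiv_eq_zero_of_notMem_closure hx.2]
    have hinner : IntegrableOn (fun x => hsInner (f' x) (G x)) U volume :=
      (hf'c.hsInner hGc).integrableOn_of_eq_zero_off_compact hUm hK hKU fun x hx => by
        rw [hG0 x hx, hsInner_zero_right]
    have hsq : IntegrableOn (fun x => hsNormSq (G x)) U volume :=
      hGc.hsNormSq.integrableOn_of_eq_zero_off_compact hUm hK hKU fun x hx => by
        rw [hG0 x hx, hsNormSq_zero]
    have hexpand : (fun t : ℝ =>
        ∫ x in U, hsNormSq (fderiv ℝ (fun z => f z + t • Y (z, f z)) x)) = fun t : ℝ =>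
        (∫ x in U, hsNormSq (f' x)) + t * (2 * ∫ x in U, hsInner (f' x) (G x))
          + t ^ 2 * ∫ x in U, hsNormSq (G x) := by
      funext t
      rw [← integral_const_mul, ← integral_const_mul, ← integral_const_mul,
        ← integral_add hfin ((hinner.const_mul 2).const_mul t),
        ← integral_add (hfin.fun_add ((hinner.const_mul 2).const_mul t)) (hsq.const_mul _)]
      refine setIntegral_congr_fun hUm fun x hx => ?_
      simp only [fderiv_outer_variation (hf x hx) hY, hsNormSq_add_smul, hG]
    rw [hexpand]
    have hlin := (hasDerivAt_id (0 : ℝ)).mul_const (2 * ∫ x in U, hsInner (f' x) (G x))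
    have hquad := (hasDerivAt_pow 2 (0 : ℝ)).mul_const (∫ x in U, hsNormSq (G x))
    refine ((hlin.const_add (∫ x in U, hsNormSq (f' x))).fun_add hquad).congr_deriv ?_
    simp [hG]
  have hsplit : ∀ Y : Em m × ell2 → ell2, ContDiff ℝ 1 Y →
      IsCompact (closure {x : Em m | ∃ y, Y (x, y) ≠ 0}) →
      closure {x : Em m | ∃ y, Y (x, y) ≠ 0} ⊆ U →
      ∫ x in U, hsInner (f' x)
          ((fderiv ℝ Y (x, f x)).comp (ContinuousLinearMap.inl ℝ (Em m) ell2)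
            + ((fderiv ℝ Y (x, f x)).comp
                (ContinuousLinearMap.inr ℝ (Em m) ell2)).comp (f' x)) =
        (∫ x in U, hsInner (f' x)
            ((fderiv ℝ Y (x, f x)).comp (ContinuousLinearMap.inl ℝ (Em m) ell2)))
          + (∫ x in U, hsInner (f' x)
              (((fderiv ℝ Y (x, f x)).comp
                  (ContinuousLinearMap.inr ℝ (Em m) ell2)).comp (f' x))) := by
    intro Y hY hK hKU
    simp only [hsInner_add_right]
    refine integral_add
      ((hf'c.hsInner (hDx Y hY)).integrableOn_of_eq_zero_off_compact hUm hK hKU fun x hx => ?_)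
      ((hf'c.hsInner (hDy Y hY)).integrableOn_of_eq_zero_off_compact hUm hK hKU fun x hx => ?_)
    all_goals simp [fderiv_eq_zero_of_notMem_closure hx.2, hsInner_zero_right]
  refine ⟨fun Y hY _ _ hK hKU => hvar Y hY hK hKU, fun h Y hY hb hb' hK hKU => ?_,
    fun h Y hY hb hb' hK hKU => ?_⟩
  · have huniq := (hvar Y hY hK hKU).unique (h Y hY hb hb' hK hKU)
    rw [← hsplit Y hY hK hKU]
    linarith
  · have hder := hvar Y hY hK hKU
    rwa [hsplit Y hY hK hKU, h Y hY hb hb' hK hKU, mul_zero] at hder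
end
end

section
/- Assume f is squash stationary. If a ∈ U and 0 < r₀ < dist(a, ℝ^m ∖ U) are such that H_a(r₀) = ∫_{∂B(a,r₀)} ‖f‖² dℋ^{m−1} = 0, then f(x) = 0 for every x ∈ B(a, r₀). -/
open MeasureTheory Metric
open scoped RealInnerProductSpace ENNReal NNReal Topology
noncomputable section

/-- The radial projection onto the sphere `∂B(a,r)` of the hyperplane `{z : z i = s}`,
parametrised by the remaining coordinates. -/
def sphereChart {n : ℕ} (a : Em (n + 1)) (r : ℝ) (i : Fin (n + 1)) (s : ℝ) (y : Fin n → ℝ) :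
    Em (n + 1) :=
  a + (r * ‖WithLp.toLp 2 (i.insertNth (α := fun _ => ℝ) s y)‖⁻¹) •
    WithLp.toLp 2 (i.insertNth (α := fun _ => ℝ) s y)

theorem toLp_insertNth_ne_zero {n : ℕ} (i : Fin (n + 1)) {s : ℝ} (hs : s ≠ 0) (y : Fin n → ℝ) :
    (WithLp.toLp 2 (i.insertNth (α := fun _ => ℝ) s y) : Em (n + 1)) ≠ 0 := by
  intro h
  apply hs
  have := congrArg (fun z : Em (n + 1) => z i) h
  simpa using this

theorem contDiff_sphereChart {n : ℕ} (a : Em (n + 1)) (r : ℝ) (i : Fin (n + 1)) {s : ℝ}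
    (hs : s ≠ 0) : ContDiff ℝ 1 (sphereChart a r i s) := by
  have h : ContDiff ℝ 1 (fun y : Fin n → ℝ =>
      (WithLp.toLp 2 (i.insertNth (α := fun _ => ℝ) s y) : Em (n + 1))) := by
    rw [contDiff_euclidean]
    intro k
    refine Fin.succAboveCases i ?_ (fun j => ?_) k
    · simpa using contDiff_const
    · simpa using contDiff_apply ℝ ℝ j
  exact contDiff_const.add ((contDiff_const.mul
    ((h.norm ℝ (toLp_insertNth_ne_zero i hs)).inv
      fun y => norm_ne_zero_iff.2 (toLp_insertNth_ne_zero i hs y))).smul h)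

theorem sphereChart_mem_sphere {n : ℕ} (a : Em (n + 1)) {r : ℝ} (hr : 0 < r) (i : Fin (n + 1))
    {s : ℝ} (hs : s ≠ 0) (y : Fin n → ℝ) : sphereChart a r i s y ∈ sphere a r := by
  have h := norm_ne_zero_iff.2 (toLp_insertNth_ne_zero i hs y)
  rw [mem_sphere_iff_norm, sphereChart, add_sub_cancel_left, norm_smul, norm_mul, norm_inv,
    norm_norm, Real.norm_of_nonneg hr.le, mul_assoc, inv_mul_cancel₀ h, mul_one]

theorem exists_sphereChart_eq {n : ℕ} {a : Em (n + 1)} {r : ℝ} (hr : 0 < r) {x : Em (n + 1)}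
    (hx : x ∈ sphere a r) :
    ∃ (i : Fin (n + 1)) (s : ℝ), (s = 1 ∨ s = -1) ∧
      ∃ y ∈ closedBall (0 : Fin n → ℝ) 1, sphereChart a r i s y = x := by
  obtain ⟨i, -, hi⟩ := Finset.exists_max_image Finset.univ (fun j => |(x - a) j|)
    Finset.univ_nonempty
  have hxa : ‖x - a‖ = r := mem_sphere_iff_norm.1 hx
  have hpos : 0 < |(x - a) i| := by
    by_contra h
    have h0 : x - a = 0 := by
      ext j
      exact abs_nonpos_iff.1 ((hi j (Finset.mem_univ j)).trans (not_lt.1 h))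
    rw [h0, norm_zero] at hxa
    exact hr.ne hxa
  set c := |(x - a) i| with hc
  refine ⟨i, (x - a) i / c, ?_, fun j => (x - a) (i.succAbove j) / c, ?_, ?_⟩
  · rcases le_total 0 ((x - a) i) with h | h
    · left; rw [hc, abs_of_nonneg h]; rw [abs_of_nonneg h] at hc; exact div_self (hc ▸ hpos.ne')
    · right; rw [hc, abs_of_nonpos h]; rw [abs_of_nonpos h] at hc
      rw [div_neg, div_self]; intro h0; rw [h0] at hc; simp [hc] at hpos
  · rw [mem_closedBall_zero_iff, pi_norm_le_iff_of_nonneg zero_le_one]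
    intro j
    rw [Real.norm_eq_abs, abs_div, abs_of_pos hpos, div_le_one hpos]
    exact hi _ (Finset.mem_univ _)
  · have h : (WithLp.toLp 2 (i.insertNth (α := fun _ => ℝ) ((x - a) i / c)
        (fun j => (x - a) (i.succAbove j) / c)) : Em (n + 1)) = c⁻¹ • (x - a) := by
      ext k
      refine Fin.succAboveCases i ?_ (fun j => ?_) k <;> simp [div_eq_inv_mul]
    rw [sphereChart, h, norm_smul, hxa, norm_inv, Real.norm_of_nonneg hpos.le, smul_smul]
    have : r * (c⁻¹ * r)⁻¹ * c⁻¹ = 1 := by field_simp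
    rw [this, one_smul, add_sub_cancel]

theorem hausdorffMeasure_fin_pi_real (n : ℕ) :
    (μH[(n : ℝ)] : Measure (Fin n → ℝ)) = volume := by
  rw [← hausdorffMeasure_pi_real, Fintype.card_fin]

theorem hausdorffMeasure_sphere_lt_top {n : ℕ} (a : Em (n + 1)) {r : ℝ} (hr : 0 < r) :
    μH[(n : ℝ)] (sphere a r) < ∞ := by
  have key : ∀ (i : Fin (n + 1)) (s : ℝ), s ≠ 0 →
      μH[(n : ℝ)] (sphereChart a r i s '' closedBall 0 1) < ∞ := by
    intro i s hs
    obtain ⟨K, hK⟩ := (contDiff_sphereChart a r i hs).contDiffOn.exists_lipschitzOnWith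
      one_ne_zero (convex_closedBall (0 : Fin n → ℝ) 1) (isCompact_closedBall _ _)
    refine (hK.hausdorffMeasure_image_le n.cast_nonneg).trans_lt ?_
    rw [hausdorffMeasure_fin_pi_real]
    exact ENNReal.mul_lt_top (by simp) measure_closedBall_lt_top
  have hsub : sphere a r ⊆ ⋃ i : Fin (n + 1), (sphereChart a r i 1 '' closedBall 0 1 ∪
      sphereChart a r i (-1) '' closedBall 0 1) := by
    intro x hx
    obtain ⟨i, s, rfl | rfl, y, hy, rfl⟩ := exists_sphereChart_eq hr hx
    · exact Set.mem_iUnion.2 ⟨i, Or.inl ⟨y, hy, rfl⟩⟩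
    · exact Set.mem_iUnion.2 ⟨i, Or.inr ⟨y, hy, rfl⟩⟩
  refine (measure_mono hsub).trans_lt ((measure_iUnion_le _).trans_lt ?_)
  rw [tsum_fintype]
  refine ENNReal.sum_lt_top.2 fun i _ => (measure_union_le _ _).trans_lt ?_
  exact ENNReal.add_lt_top.2 ⟨key i 1 one_ne_zero, key i (-1) (by norm_num)⟩

theorem hausdorffMeasure_sphere_inter_pos {n : ℕ} {a : Em (n + 1)} {r : ℝ} (hr : 0 < r)
    {x : Em (n + 1)} (hx : x ∈ sphere a r) {N : Set (Em (n + 1))} (hN : N ∈ 𝓝 x) :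
    0 < μH[(n : ℝ)] (sphere a r ∩ N) := by
  obtain ⟨i, s, hs, y₀, -, rfl⟩ := exists_sphereChart_eq hr hx
  have hs0 : s ≠ 0 := by rcases hs with rfl | rfl <;> norm_num
  have hcoord : ∀ y k, (sphereChart a r i s y - a) k =
      r * ‖(WithLp.toLp 2 (i.insertNth (α := fun _ => ℝ) s y) : Em (n + 1))‖⁻¹ *
        i.insertNth (α := fun _ => ℝ) s y k := by
    intro y k
    simp [sphereChart]
  have hc : ∀ y, r * ‖(WithLp.toLp 2 (i.insertNth (α := fun _ => ℝ) s y) : Em (n + 1))‖⁻¹ ≠ 0 :=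
    fun y => mul_ne_zero hr.ne'
      (inv_ne_zero (norm_ne_zero_iff.2 (toLp_insertNth_ne_zero i hs0 y)))
  let L : Em (n + 1) → (Fin n → ℝ) := fun z j => s * (z - a) (i.succAbove j) / (z - a) i
  have hL : ∀ y, L (sphereChart a r i s y) = y := by
    intro y
    funext j
    have hcy := hc y
    simp only [L, hcoord, Fin.insertNth_apply_same, Fin.insertNth_apply_succAbove]
    rw [mul_left_comm, mul_comm s, mul_div_mul_left _ _ hcy, mul_div_cancel_right₀ _ hs0]
  have hLd : ContDiffAt ℝ 1 L (sphereChart a r i s y₀) := by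
    have hk : ∀ k : Fin (n + 1), ContDiff ℝ 1 fun z : Em (n + 1) => (z - a) k := fun k =>
      contDiff_euclidean.1 (contDiff_id.sub contDiff_const) k
    rw [contDiffAt_pi]
    intro j
    refine ((contDiff_const.mul (hk _)).contDiffAt).div (hk i).contDiffAt ?_
    rw [hcoord, Fin.insertNth_apply_same]
    exact mul_ne_zero (hc y₀) hs0
  obtain ⟨K, t, ht, hK⟩ := hLd.exists_lipschitzOnWith
  have hpre : sphereChart a r i s ⁻¹' (N ∩ t) ∈ 𝓝 y₀ :=
    (contDiff_sphereChart a r i hs0).continuous.continuousAt (Filter.inter_mem hN ht)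
  have hpos : 0 < volume (sphereChart a r i s ⁻¹' (N ∩ t)) := Measure.measure_pos_of_mem_nhds _ hpre
  have hsub : sphereChart a r i s ⁻¹' (N ∩ t) ⊆ L '' (sphere a r ∩ N ∩ t) := fun y hy =>
    ⟨_, ⟨⟨sphereChart_mem_sphere a hr i hs0 y, hy.1⟩, hy.2⟩, hL y⟩
  have hle : volume (L '' (sphere a r ∩ N ∩ t)) ≤
      (K : ℝ≥0∞) ^ (n : ℝ) * μH[(n : ℝ)] (sphere a r ∩ N ∩ t) := by
    rw [← hausdorffMeasure_fin_pi_real]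
    exact (hK.mono Set.inter_subset_right).hausdorffMeasure_image_le n.cast_nonneg
  refine pos_iff_ne_zero.2 fun h0 => ?_
  rw [measure_mono_null Set.inter_subset_left h0, mul_zero] at hle
  exact (hpos.trans_le (measure_mono hsub)).not_ge hle

/-- A continuous map whose square norm has vanishing integral over a sphere vanishes there. -/
theorem eq_zero_of_integral_sphere_eq_zero {n : ℕ} {F : Type*} [NormedAddCommGroup F]
    {a : Em (n + 1)} {r : ℝ} (hr : 0 < r) {f : Em (n + 1) → F}
    (hf : ∀ x ∈ sphere a r, ContinuousAt f x)
    (h : ∫ x in sphere a r, ‖f x‖ ^ 2 ∂μH[(n : ℝ)] = 0) :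
    ∀ x ∈ sphere a r, f x = 0 := by
  have : IsFiniteMeasure ((μH[(n : ℝ)] : Measure (Em (n + 1))).restrict (sphere a r)) :=
    ⟨by simpa using hausdorffMeasure_sphere_lt_top a hr⟩
  have hcont : ContinuousOn (fun x => ‖f x‖ ^ 2) (sphere a r) := fun x hx =>
    ((hf x hx).norm.pow 2).continuousWithinAt
  obtain ⟨C, hC⟩ := (isCompact_sphere a r).exists_bound_of_continuousOn hcont
  have hmeas : MeasurableSet (sphere a r) := isClosed_sphere.measurableSet
  have hint : IntegrableOn (fun x => ‖f x‖ ^ 2) (sphere a r) μH[(n : ℝ)] :=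
    Integrable.of_bound (hcont.aestronglyMeasurable hmeas) C
      ((ae_restrict_iff' hmeas).2 (Filter.Eventually.of_forall hC))
  have hae := (setIntegral_eq_zero_iff_of_nonneg_ae
    (Filter.Eventually.of_forall fun x => by positivity) hint).1 h
  rw [Filter.EventuallyEq, ae_restrict_iff' hmeas] at hae
  intro x hx
  by_contra hne
  have hN := (hf x hx).eventually_ne hne
  refine (hausdorffMeasure_sphere_inter_pos hr hx hN).ne' ?_
  refine measure_mono_null ?_ hae
  rintro z ⟨hz, hz0⟩ hall
  have := hall hz
  simp only [Pi.zero_apply, pow_eq_zero_iff two_ne_zero, norm_eq_zero] at this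
  exact hz0 this

theorem hasDerivAt_max_sub_zero_sq (ε s : ℝ) :
    HasDerivAt (fun s : ℝ => max (s - ε) 0 ^ 2) (2 * max (s - ε) 0) s := by
  rcases lt_trichotomy s ε with h | rfl | h
  · rw [max_eq_right (sub_nonpos.2 h.le), mul_zero]
    refine (hasDerivAt_const s (0 : ℝ)).congr_of_eventuallyEq ?_
    filter_upwards [eventually_lt_nhds h] with z hz
    rw [max_eq_right (sub_nonpos.2 hz.le), zero_pow two_ne_zero]
  · rw [sub_self, max_self, mul_zero]
    have hO : (fun z : ℝ => max (z - s) 0 ^ 2) =O[𝓝 s] fun z => ‖z - s‖ ^ 2 := by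
      refine Asymptotics.IsBigO.of_bound 1 (Filter.Eventually.of_forall fun z => ?_)
      rw [one_mul, norm_pow, norm_pow, norm_norm]
      refine pow_le_pow_left₀ (norm_nonneg _) ?_ 2
      rw [Real.norm_of_nonneg (le_max_right _ _)]
      exact max_le (le_abs_self _) (abs_nonneg _)
    simpa [HasDerivAt, HasDerivAtFilter] using
      (hO.hasFDerivAt (𝕜 := ℝ) one_lt_two).hasDerivAt
  · rw [max_eq_left (sub_nonneg.2 h.le)]
    have h1 : HasDerivAt (fun z : ℝ => (z - ε) ^ 2) (2 * (s - ε)) s := by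
      have := ((hasDerivAt_id' s).sub_const ε).fun_pow 2
      simpa using this
    refine h1.congr_of_eventuallyEq ?_
    filter_upwards [eventually_gt_nhds h] with z hz
    rw [max_eq_left (sub_nonneg.2 hz.le)]

/-- If `u` vanishes on `∂B(a,r)`, then `((u - ε)⁺)²`, extended by zero from `B(a,r)`, is of
class `C¹`. -/
theorem hasFDerivAt_indicator_max_sub_zero_sq {m : ℕ} {U : Set (Em m)} (hU : IsOpen U)
    {u : Em m → ℝ} {u' : Em m → (Em m →L[ℝ] ℝ)} (hu : ∀ x ∈ U, HasFDerivAt u (u' x) x)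
    (hu'c : ContinuousOn u' U) {a : Em m} {r : ℝ} (hball : closedBall a r ⊆ U)
    (hu0 : ∀ x ∈ sphere a r, u x = 0) {ε : ℝ} (hε : 0 < ε) :
    (∀ x, HasFDerivAt ((ball a r).indicator fun x => max (u x - ε) 0 ^ 2)
      ((ball a r).indicator (fun x => (2 * max (u x - ε) 0) • u' x) x) x) ∧
    Continuous ((ball a r).indicator fun x => (2 * max (u x - ε) 0) • u' x) := by
  have hucont : ∀ x ∈ U, ContinuousAt u x := fun x hx => (hu x hx).continuousAt
  have hout : ∀ x ∉ ball a r, ∀ᶠ z in 𝓝 x, z ∈ ball a r → max (u z - ε) 0 = 0 := by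
    intro x hx
    by_cases hxs : x ∈ closedBall a r
    · have hxs' : x ∈ sphere a r := by
        rw [← closedBall_sdiff_ball]; exact ⟨hxs, hx⟩
      have hlt : u x < ε := by rw [hu0 x hxs']; exact hε
      filter_upwards [(hucont x (hball hxs)).eventually (eventually_lt_nhds hlt)] with z hz _
      exact max_eq_right (sub_nonpos.2 hz.le)
    · filter_upwards [isClosed_closedBall.isOpen_compl.mem_nhds hxs] with z hz hzb
      exact absurd (ball_subset_closedBall hzb) hz
  constructor
  · intro x
    by_cases hx : x ∈ ball a r
    · rw [Set.indicator_of_mem hx]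
      refine ((hasDerivAt_max_sub_zero_sq ε (u x)).comp_hasFDerivAt x
        (hu x (hball (ball_subset_closedBall hx)))).congr_of_eventuallyEq ?_
      filter_upwards [isOpen_ball.mem_nhds hx] with z hz
      rw [Set.indicator_of_mem hz]
      rfl
    · rw [Set.indicator_of_notMem hx]
      refine (hasFDerivAt_const (0 : ℝ) x).congr_of_eventuallyEq ?_
      filter_upwards [hout x hx] with z hz
      by_cases hzb : z ∈ ball a r
      · rw [Set.indicator_of_mem hzb, hz hzb, zero_pow two_ne_zero]
      · rw [Set.indicator_of_notMem hzb]
  · rw [continuous_iff_continuousAt]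
    intro x
    by_cases hx : x ∈ ball a r
    · have hxU := hball (ball_subset_closedBall hx)
      have hc : ContinuousAt (fun x => (2 * max (u x - ε) 0) • u' x) x :=
        (continuousAt_const.mul (((hucont x hxU).sub continuousAt_const).max
          continuousAt_const)).smul (hu'c.continuousAt (hU.mem_nhds hxU))
      refine hc.congr ?_
      filter_upwards [isOpen_ball.mem_nhds hx] with z hz
      rw [Set.indicator_of_mem hz]
    · refine (continuousAt_const (y := (0 : Em m →L[ℝ] ℝ))).congr ?_
      filter_upwards [hout x hx] with z hz
      by_cases hzb : z ∈ ball a r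
      · rw [Set.indicator_of_mem hzb, hz hzb, mul_zero, zero_smul]
      · rw [Set.indicator_of_notMem hzb]

theorem hsNormSq_add_smul_smulRight {m : ℕ} (A : Em m →L[ℝ] ell2) (l : Em m →L[ℝ] ℝ) (v : ell2)
    (t : ℝ) :
    hsNormSq (A + t • l.smulRight v) =
      hsNormSq A + t * (2 * hsInner A (l.smulRight v)) + t ^ 2 * hsNormSq (l.smulRight v) := by
  simp only [hsNormSq, hsInner, Finset.mul_sum, ← Finset.sum_add_distrib]
  refine Finset.sum_congr rfl fun i _ => ?_
  rw [add_apply, smul_apply, norm_add_sq_real,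
    inner_smul_right, norm_smul, mul_pow, Real.norm_eq_abs, sq_abs]
  ring

theorem continuousOn_hsInner_smulRight {m : ℕ} {U : Set (Em m)} {f' : Em m → (Em m →L[ℝ] ell2)}
    {g' : Em m → (Em m →L[ℝ] ℝ)} (hf'c : ContinuousOn f' U) (hg'c : Continuous g') (v : ell2) :
    ContinuousOn (fun x => hsInner (f' x) ((g' x).smulRight v)) U := by
  refine continuousOn_finsetSum _ fun i _ => ?_
  refine (hf'c.clm_apply continuousOn_const).inner ?_
  exact (((hg'c.clm_apply continuous_const).smul continuous_const).continuousOn :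
    ContinuousOn (fun x => g' x (EuclideanSpace.single i 1) • v) U)

/-- The first variation formula for outer variations of the form `f + t g v`, with `g` a
compactly supported scalar `C¹` function and `v` a fixed vector. -/
theorem SquashStationary.integral_hsInner_eq_zero {m : ℕ} {U : Set (Em m)} (hU : IsOpen U)
    {f : Em m → ell2} {f' : Em m → (Em m →L[ℝ] ell2)} (hf : ∀ x ∈ U, HasFDerivAt f (f' x) x)
    (hf'c : ContinuousOn f' U) (hfin : IntegrableOn (fun x => hsNormSq (f' x)) U volume)
    (hstat : SquashStationary U f) {g : Em m → ℝ} {g' : Em m → (Em m →L[ℝ] ℝ)}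
    (hg : ∀ x, HasFDerivAt g (g' x) x) (hg'c : Continuous g') (hgs : HasCompactSupport g)
    (hgU : tsupport g ⊆ U) (v : ell2) :
    IntegrableOn (fun x => hsInner (f' x) ((g' x).smulRight v)) U ∧
      ∫ x in U, hsInner (f' x) ((g' x).smulRight v) = 0 := by
  have hgf : fderiv ℝ g = g' := funext fun x => (hg x).fderiv
  have hgd : ContDiff ℝ 1 g := contDiff_one_iff_hasFDerivAt.2 ⟨g', hg'c, hg⟩
  have hg'0 : ∀ x ∈ U \ tsupport g, g' x = 0 := by
    intro x hx
    by_contra h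
    exact hx.2 (tsupport_fderiv_subset ℝ (subset_tsupport _ (by rwa [hgf])))
  have hYd : ∀ p : Em m × ell2, HasFDerivAt (fun p : Em m × ell2 => g p.1 • v)
      (((g' p.1).comp (ContinuousLinearMap.fst ℝ (Em m) ell2)).smulRight v) p := fun p =>
    ((hg p.1).comp p hasFDerivAt_fst).smul_const v
  have hsub : closure {x : Em m | ∃ _ : ell2, g x • v ≠ 0} ⊆ tsupport g := by
    refine closure_mono ?_
    rintro x ⟨-, hx⟩ h0
    exact hx (by rw [h0, zero_smul])
  obtain ⟨C, hC⟩ := hgs.exists_bound_of_continuous hgd.continuous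
  obtain ⟨C', hC'⟩ := (hgf ▸ hgs.fderiv ℝ : HasCompactSupport g').exists_bound_of_continuous hg'c
  have hder : HasDerivAt
      (fun t : ℝ => ∫ x in U, hsNormSq (fderiv ℝ (fun z => f z + t • g z • v) x)) 0 0 :=
    hstat (fun p => g p.1 • v) ((hgd.comp contDiff_fst).smul contDiff_const)
    ⟨C * ‖v‖, fun p => by
      rw [norm_smul]; exact mul_le_mul_of_nonneg_right (hC _) (norm_nonneg _)⟩
    ⟨C' * ‖v‖, fun p => by
      rw [(hYd p).fderiv, ContinuousLinearMap.norm_smulRight_apply]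
      refine mul_le_mul_of_nonneg_right ?_ (norm_nonneg _)
      refine (ContinuousLinearMap.opNorm_comp_le _ _).trans ?_
      refine (mul_le_of_le_one_right (norm_nonneg _)
        (ContinuousLinearMap.norm_fst_le _ _ _)).trans (hC' _)⟩
    (hgs.isCompact.of_isClosed_subset isClosed_closure hsub) (hsub.trans hgU)
  have hint : ∀ b : Em m → ℝ, ContinuousOn b U → (∀ x ∈ U \ tsupport g, b x = 0) →
      IntegrableOn b U := fun b hb hb0 =>
    ((hb.mono hgU).integrableOn_compact hgs.isCompact).of_forall_sdiff_eq_zero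
      hU.measurableSet hb0
  have hI : IntegrableOn (fun x => hsInner (f' x) ((g' x).smulRight v)) U :=
    hint _ (continuousOn_hsInner_smulRight hf'c hg'c v) fun x hx => by
      simp [hsInner, hg'0 x hx]
  have hJ : IntegrableOn (fun x => hsNormSq ((g' x).smulRight v)) U := by
    refine hint _ ?_ fun x hx => by simp [hsNormSq, hg'0 x hx]
    refine continuousOn_finsetSum _ fun i _ => ?_
    exact ((((hg'c.clm_apply continuous_const).smul continuous_const).norm.pow 2).continuousOn :
      ContinuousOn (fun x => ‖g' x (EuclideanSpace.single i 1) • v‖ ^ 2) U)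
  refine ⟨hI, ?_⟩
  have hE : (fun t : ℝ => ∫ x in U, hsNormSq (fderiv ℝ (fun z => f z + t • g z • v) x)) =
      fun t => (∫ x in U, hsNormSq (f' x)) +
        t * (2 * ∫ x in U, hsInner (f' x) ((g' x).smulRight v)) +
        t ^ 2 * ∫ x in U, hsNormSq ((g' x).smulRight v) := by
    funext t
    rw [← integral_const_mul, ← integral_const_mul, ← integral_const_mul,
      ← integral_add hfin ((hI.const_mul 2).const_mul t),
      ← integral_add (Integrable.fun_add hfin ((hI.const_mul 2).const_mul t)) (hJ.const_mul (t ^ 2))]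
    refine setIntegral_congr_fun hU.measurableSet fun x hx => ?_
    have h : HasFDerivAt (fun z => f z + t • g z • v) (f' x + t • (g' x).smulRight v) x :=
      (hf x hx).add (((hg x).smul_const v).const_smul t)
    simp only [h.fderiv, hsNormSq_add_smul_smulRight]
  simp only [hE] at hder
  have hpoly : ∀ A B C : ℝ, HasDerivAt (fun t : ℝ => A + t * (2 * B) + t ^ 2 * C) (2 * B) 0 := by
    intro A B C
    have := (((hasDerivAt_id' (0 : ℝ)).mul_const (2 * B)).const_add A).fun_add
      (((hasDerivAt_id' (0 : ℝ)).fun_pow 2).mul_const C)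
    simpa using this
  have := (hpoly _ _ _).unique hder
  linarith

theorem clm_eq_zero_of_sum_sq_eq_zero {m : ℕ} {l : Em m →L[ℝ] ℝ}
    (h : ∑ i : Fin m, l (EuclideanSpace.single i 1) ^ 2 = 0) : l = 0 := by
  rw [Finset.sum_eq_zero_iff_of_nonneg fun i _ => sq_nonneg _] at h
  have hb : (l : Em m →ₗ[ℝ] ℝ) = 0 :=
    (EuclideanSpace.basisFun (Fin m) ℝ).toBasis.ext fun i => by
      simpa using h i (Finset.mem_univ i)
  exact ContinuousLinearMap.coe_injective hb

/-- A weak maximum principle: if `f` is squash stationary and vanishes on `∂B(a,r)`, then no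
component of `f` exceeds `ε > 0` in `B(a,r)`. -/
theorem SquashStationary.inner_le_of_sphere_eq_zero {m : ℕ} {U : Set (Em m)} (hU : IsOpen U)
    {f : Em m → ell2} {f' : Em m → (Em m →L[ℝ] ell2)} (hf : ∀ x ∈ U, HasFDerivAt f (f' x) x)
    (hf'c : ContinuousOn f' U) (hfin : IntegrableOn (fun x => hsNormSq (f' x)) U volume)
    (hstat : SquashStationary U f) {a : Em m} {r : ℝ} (hball : closedBall a r ⊆ U)
    (hnt : (ball a r)ᶜ.Nonempty)
    (hf0 : ∀ x ∈ sphere a r, f x = 0) (v : ell2) {ε : ℝ} (hε : 0 < ε) :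
    ∀ x ∈ ball a r, ⟪v, f x⟫ ≤ ε := by
  set u : Em m → ℝ := fun x => ⟪v, f x⟫ with hu_def
  set u' : Em m → (Em m →L[ℝ] ℝ) := fun x => (innerSL ℝ v).comp (f' x) with hu'_def
  have hu : ∀ x ∈ U, HasFDerivAt u (u' x) x := fun x hx =>
    (innerSL ℝ v).hasFDerivAt.comp x (hf x hx)
  have hu'c : ContinuousOn u' U := continuousOn_const.clm_comp hf'c
  obtain ⟨hg, hg'c⟩ := hasFDerivAt_indicator_max_sub_zero_sq hU hu hu'c hball
    (fun x hx => by simp [hu_def, hf0 x hx]) hε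
  set g := (ball a r).indicator fun x => max (u x - ε) 0 ^ 2 with hg_def
  set g' := (ball a r).indicator fun x => (2 * max (u x - ε) 0) • u' x with hg'_def
  have hgt : tsupport g ⊆ closedBall a r :=
    closure_minimal (Set.support_indicator_subset.trans ball_subset_closedBall)
      isClosed_closedBall
  have hgs : HasCompactSupport g :=
    (isCompact_closedBall a r).of_isClosed_subset (isClosed_tsupport g) hgt
  obtain ⟨hI, h0⟩ := hstat.integral_hsInner_eq_zero hU hf hf'c hfin hg hg'c hgs
    (hgt.trans hball) v
  have hval : ∀ x, hsInner (f' x) ((g' x).smulRight v) = (ball a r).indicator (fun x =>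
      2 * max (u x - ε) 0 * ∑ i, u' x (EuclideanSpace.single i 1) ^ 2) x := by
    intro x
    by_cases hx : x ∈ ball a r
    · simp only [hsInner, hg'_def, Set.indicator_of_mem hx, Finset.mul_sum]
      refine Finset.sum_congr rfl fun i _ => ?_
      simp only [ContinuousLinearMap.smulRight_apply, smul_apply,
        inner_smul_right, smul_eq_mul, hu'_def, ContinuousLinearMap.comp_apply,
        innerSL_apply_apply, real_inner_comm v]
      ring
    · simp [hsInner, hg'_def, Set.indicator_of_notMem hx]
  have hnn : ∀ x, 0 ≤ hsInner (f' x) ((g' x).smulRight v) := fun x => by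
    rw [hval]
    exact Set.indicator_nonneg (fun x _ => mul_nonneg (mul_nonneg two_pos.le (le_max_right _ _))
      (Finset.sum_nonneg fun i _ => sq_nonneg _)) x
  have hae := (setIntegral_eq_zero_iff_of_nonneg_ae (Filter.Eventually.of_forall hnn) hI).1 h0
  have heq := Measure.eqOn_open_of_ae_eq hae hU
    (continuousOn_hsInner_smulRight hf'c hg'c v) continuousOn_const
  have hg'0 : ∀ x, g' x = 0 := by
    intro x
    by_cases hx : x ∈ ball a r
    · have h := heq (hball (ball_subset_closedBall hx))
      simp only [hval, Set.indicator_of_mem hx, Pi.zero_apply] at h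
      simp only [hg'_def, Set.indicator_of_mem hx]
      rcases mul_eq_zero.1 h with h | h
      · rw [h, zero_smul]
      · rw [clm_eq_zero_of_sum_sq_eq_zero h, smul_zero]
    · exact Set.indicator_of_notMem hx _
  obtain ⟨z, hz⟩ := hnt
  intro x hx
  have hconst : g x = g z := is_const_of_fderiv_eq_zero (𝕜 := ℝ)
    (fun y => (hg y).differentiableAt) (fun y => by rw [(hg y).fderiv, hg'0]) x z
  rw [hg_def, Set.indicator_of_notMem hz, Set.indicator_of_mem hx, pow_eq_zero_iff two_ne_zero,
    max_eq_right_iff, sub_nonpos] at hconst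
  exact hconst

/-- If `f` is squash stationary and `H_a(r₀) = ∫_{∂B(a,r₀)} ‖f‖² dℋ^{m−1}`
vanishes, then `f ≡ 0` on `B(a,r₀)`. -/
theorem stmt9 (m : ℕ) (hm : 2 ≤ m) (U : Set (Em m)) (hU : IsOpen U)
    (f : Em m → ell2) (f' : Em m → (Em m →L[ℝ] ell2))
    (hf : ∀ x ∈ U, HasFDerivAt f (f' x) x) (hf'c : ContinuousOn f' U)
    (hfin : IntegrableOn (fun x => hsNormSq (f' x)) U volume)
    (hstat : SquashStationary U f) (a : Em m) (ha : a ∈ U)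
    (r₀ : ℝ) (hr₀ : 0 < r₀) (hr₀U : r₀ < Metric.infDist a Uᶜ)
    (hH : ∫ x in Metric.sphere a r₀, ‖f x‖ ^ 2 ∂(μH[((m : ℝ) - 1)]) = 0) :
    ∀ x ∈ Metric.ball a r₀, f x = 0 := by
  obtain ⟨n, rfl⟩ : ∃ n, m = n + 1 := ⟨m - 1, by omega⟩
  have hball : closedBall a r₀ ⊆ U :=
    (closedBall_subset_ball hr₀U).trans ball_infDist_compl_subset
  have hnt : (ball a r₀)ᶜ.Nonempty := by
    have hne : Uᶜ.Nonempty := by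
      by_contra h
      rw [Set.not_nonempty_iff_eq_empty.1 h, infDist_empty] at hr₀U
      exact hr₀.not_gt hr₀U
    exact hne.mono (Set.compl_subset_compl.2 (ball_subset_closedBall.trans hball))
  rw [Nat.cast_add, Nat.cast_one, add_sub_cancel_right] at hH
  have hf0 := eq_zero_of_integral_sphere_eq_zero hr₀
    (fun x hx => (hf x (hball (sphere_subset_closedBall hx))).continuousAt) hH
  intro x hx
  have h : ⟪f x, f x⟫ ≤ 0 := le_of_forall_pos_le_add fun ε hε => by
    rw [zero_add]
    exact hstat.inner_le_of_sphere_eq_zero hU hf hf'c hfin hball hnt hf0 (f x) hε x hx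
  rw [real_inner_self_eq_norm_sq] at h
  exact norm_eq_zero.1 (pow_eq_zero_iff two_ne_zero |>.1 (h.antisymm (sq_nonneg _)))
end
end
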